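/- arXiv:2303.05314 — 3 statements merged into one kernel-verified Lean document; each statement's English description precedes it below -/
import Mathlib

section
/- For every prime p ≥ 5, the set of positive integers n for which C̄_{p,1}(n) is even is infinite. -/
/-- Andrews' singular overpartition function `C̄_{k,i}(n)`: the number of pairs `(λ, S)`
where `λ` is a partition of `n` with no part divisible by `k` and `S` is a set of
part-values of `λ`, each congruent to `i` or `-i` modulo `k`. -/
noncomputable def singularOverpartition (k i n : ℕ) : ℕ :=
  Nat.card {P : n.Partition × Finset ℕ //
    (∀ j ∈ P.1.parts, ¬ k ∣ j) ∧
    P.2 ⊆ P.1.parts.toFinset ∧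
    ∀ x ∈ P.2, (x : ZMod k) = (i : ZMod k) ∨ (x : ZMod k) = -(i : ZMod k)}

open Finset

section GaussBinomial

variable {R : Type*} [CommRing R]

/-- The Gaussian binomial coefficient `[i + j, i]` evaluated at `q`. -/
def gaussBinomial (q : R) : ℕ → ℕ → R
  | 0, _ => 1
  | _ + 1, 0 => 1
  | i + 1, j + 1 => gaussBinomial q (i + 1) j + q ^ (j + 1) * gaussBinomial q i (j + 1)

@[simp]
theorem gaussBinomial_zero_left (q : R) (j : ℕ) : gaussBinomial q 0 j = 1 := by
  simp [gaussBinomial]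

@[simp]
theorem gaussBinomial_zero_right (q : R) (i : ℕ) : gaussBinomial q i 0 = 1 := by
  cases i <;> simp [gaussBinomial]

theorem gaussBinomial_succ_succ (q : R) (i j : ℕ) :
    gaussBinomial q (i + 1) (j + 1) =
      gaussBinomial q (i + 1) j + q ^ (j + 1) * gaussBinomial q i (j + 1) := by
  rw [gaussBinomial]

theorem gaussBinomial_mul_prod_mul_prod (q : R) (i j : ℕ) :
    gaussBinomial q i j * (∏ l ∈ range i, (1 - q ^ (l + 1))) * ∏ l ∈ range j, (1 - q ^ (l + 1)) =
      ∏ l ∈ range (i + j), (1 - q ^ (l + 1)) := by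
  induction i generalizing j with
  | zero => simp
  | succ i ihi =>
    induction j with
    | zero => simp
    | succ j ihj =>
      have h := ihi (j + 1)
      rw [show i + 1 + (j + 1) = i + j + 1 + 1 by ring, prod_range_succ _ (i + j + 1),
        gaussBinomial_succ_succ]
      rw [show i + (j + 1) = i + j + 1 by ring, prod_range_succ _ j] at h
      rw [show i + 1 + j = i + j + 1 by ring, prod_range_succ _ i] at ihj
      rw [prod_range_succ _ i, prod_range_succ _ j]
      linear_combination (1 - q ^ (j + 1)) * ihj + q ^ (j + 1) * (1 - q ^ (i + 1)) * h

/-- The `q`-binomial theorem. -/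
theorem prod_add_mul_pow_eq_sum_gaussBinomial (q x y : R) (n : ℕ) :
    ∏ l ∈ range n, (x + y * q ^ l) =
      ∑ k ∈ antidiagonal n, gaussBinomial q k.1 k.2 * q ^ k.1.choose 2 * y ^ k.1 * x ^ k.2 := by
  induction n with
  | zero => simp
  | succ n ih =>
    let T : ℕ × ℕ → R := fun k ↦ gaussBinomial q k.1 k.2 * q ^ k.1.choose 2 * y ^ k.1 * x ^ k.2
    let U : ℕ × ℕ → R := fun k ↦ if k.2 = 0 then 0 else T (k.1, k.2 - 1) * x
    let V : ℕ × ℕ → R := fun k ↦ if k.1 = 0 then 0 else T (k.1 - 1, k.2) * (y * q ^ n)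
    have hU : ∑ k ∈ antidiagonal (n + 1), U k = ∑ k ∈ antidiagonal n, T k * x := by
      rw [Nat.sum_antidiagonal_succ']
      simp [U]
    have hV : ∑ k ∈ antidiagonal (n + 1), V k = ∑ k ∈ antidiagonal n, T k * (y * q ^ n) := by
      rw [Nat.sum_antidiagonal_succ]
      simp [V]
    rw [prod_range_succ, ih, mul_add, sum_mul, sum_mul]
    change ∑ k ∈ antidiagonal n, T k * x + ∑ k ∈ antidiagonal n, T k * (y * q ^ n) =
      ∑ k ∈ antidiagonal (n + 1), T k
    rw [← hU, ← hV, ← sum_add_distrib]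
    refine sum_congr rfl ?_
    rintro ⟨i, j⟩ hk
    rw [HasAntidiagonal.mem_antidiagonal] at hk
    rcases i with - | i <;> rcases j with - | j
    · simp at hk
    · simp [U, V, T, pow_succ]
    · obtain rfl : i = n := by simpa using hk
      simp [U, V, T, Nat.choose_succ_succ' i 1, pow_add]
      ring
    · obtain rfl : n = i + (j + 1) := by simp at hk; omega
      simp only [U, V, T, Nat.add_eq_zero_iff, one_ne_zero, and_false, if_false,
        Nat.add_sub_cancel, gaussBinomial_succ_succ, Nat.choose_succ_succ' i 1, Nat.choose_one_right]
      ring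

end GaussBinomial

section Theta

/-- The exponent `m k (k - 1) / 2 + k` of the theta series attached to `0, ±1` modulo `m`. -/
def thetaExponent (m : ℕ) (k : ℤ) : ℕ := (m * (k * (k - 1) / 2) + k).toNat

theorem two_mul_thetaExponent {m : ℕ} (hm : 3 ≤ m) (k : ℤ) :
    2 * (thetaExponent m k : ℤ) = m * (k * (k - 1)) + 2 * k := by
  have h2 : 2 * (k * (k - 1) / 2) = k * (k - 1) :=
    Int.mul_ediv_cancel' (Int.even_mul_pred_self k).two_dvd
  have hm' : (3 : ℤ) ≤ m := by exact_mod_cast hm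
  have hnn : 0 ≤ (m : ℤ) * (k * (k - 1)) + 2 * k := by
    rcases le_or_gt 0 k with hk | hk
    · rcases hk.eq_or_lt with rfl | hk
      · simp
      · have : 0 ≤ k * (k - 1) := mul_nonneg hk.le (by lia)
        positivity
    · nlinarith [mul_nonneg_of_nonpos_of_nonpos hk.le (show k - 1 ≤ 0 by lia)]
  have h : 2 * (m * (k * (k - 1) / 2) + k) = m * (k * (k - 1)) + 2 * k := by
    linear_combination (m : ℤ) * h2
  rw [thetaExponent, Int.toNat_of_nonneg (by linarith), h]

theorem abs_le_thetaExponent {m : ℕ} (hm : 3 ≤ m) (k : ℤ) : |k| ≤ thetaExponent m k := by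
  have h := two_mul_thetaExponent hm k
  have hm' : (3 : ℤ) ≤ m := by exact_mod_cast hm
  rcases le_or_gt 0 k with hk | hk
  · rw [abs_of_nonneg hk]
    have : 0 ≤ k * (k - 1) := by
      rcases hk.eq_or_lt with rfl | hk
      · simp
      · exact mul_nonneg hk.le (by lia)
    nlinarith
  · rw [abs_of_neg hk]
    nlinarith [mul_nonneg_of_nonpos_of_nonpos hk.le (show k - 1 ≤ 0 by lia)]

/-- Distinct exponents of the theta series are far apart. -/
theorem abs_le_two_mul_abs_thetaExponent_sub {m : ℕ} (hm : 3 ≤ m) {k l : ℤ} (hkl : k ≠ l) :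
    |l| ≤ 2 * |(thetaExponent m k : ℤ) - thetaExponent m l| := by
  have hm' : (3 : ℤ) ≤ m := by exact_mod_cast hm
  have h : 2 * ((thetaExponent m k : ℤ) - thetaExponent m l) =
      (k - l) * (m * (k + l - 1) + 2) := by
    linear_combination two_mul_thetaExponent hm k - two_mul_thetaExponent hm l
  have h' : 2 * |(thetaExponent m k : ℤ) - thetaExponent m l| =
      |k - l| * |m * (k + l - 1) + 2| := by
    rw [← abs_mul, ← h, abs_mul, abs_two]
  rw [h']
  have h1 : 1 ≤ |k - l| := Int.one_le_abs (sub_ne_zero.mpr hkl)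
  have h2 : 1 ≤ |m * (k + l - 1) + 2| := by
    refine Int.one_le_abs fun h0 ↦ ?_
    have : (m : ℤ) ∣ 2 := ⟨-(k + l - 1), by linarith⟩
    exact absurd (Int.le_of_dvd two_pos this) (by lia)
  rcases le_total |l| |k - l| with h3 | h3
  · nlinarith [abs_nonneg (k - l)]
  · have h4 : |l| ≤ |k + l| := by
      rcases abs_cases l with ⟨a, _⟩ | ⟨a, _⟩ <;> rcases abs_cases (k - l) with ⟨b, _⟩ | ⟨b, _⟩ <;>
        rcases abs_cases (k + l) with ⟨c, _⟩ | ⟨c, _⟩ <;> lia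
    have h5 : |k + l| ≤ |m * (k + l - 1) + 2| := by
      rcases le_or_gt (k + l) 0 with h6 | h6
      · rw [abs_of_nonpos h6, abs_of_nonpos (by nlinarith)]
        nlinarith
      · rw [abs_of_pos h6, abs_of_nonneg (by nlinarith)]
        nlinarith
    nlinarith [abs_nonneg (m * (k + l - 1) + 2)]

theorem thetaExponent_injective {m : ℕ} (hm : 3 ≤ m) : Function.Injective (thetaExponent m) := by
  intro k l hkl
  by_contra hne
  have h1 := abs_le_two_mul_abs_thetaExponent_sub hm hne
  have h2 := abs_le_two_mul_abs_thetaExponent_sub hm (Ne.symm hne)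
  rw [hkl, sub_self, abs_zero, mul_zero] at h1 h2
  exact hne ((abs_nonpos_iff.mp h2).trans (abs_nonpos_iff.mp h1).symm)

open PowerSeries

open Classical in
/-- The reduction modulo `2` of the theta series `∑ k : ℤ, X ^ (m k (k - 1) / 2 + k)`. -/
noncomputable def thetaSeries (m : ℕ) : (ZMod 2)⟦X⟧ :=
  PowerSeries.mk fun d ↦ if ∃ k, thetaExponent m k = d then 1 else 0

theorem coeff_thetaSeries_thetaExponent (m : ℕ) (k : ℤ) :
    coeff (thetaExponent m k) (thetaSeries m) = 1 := by
  simp [thetaSeries]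

theorem exists_thetaExponent_eq_of_coeff_ne_zero {m d : ℕ} (h : coeff d (thetaSeries m) ≠ 0) :
    ∃ k, thetaExponent m k = d := by
  by_contra h'
  simp [thetaSeries, h'] at h

theorem prod_theta_eq_sum_gaussBinomial {m : ℕ} (hm : 3 ≤ m) (N : ℕ) :
    ∏ l ∈ range N, (1 + (X : (ZMod 2)⟦X⟧) ^ (m * l + 1)) * (1 + X ^ (m * l + (m - 1))) =
      ∑ k ∈ antidiagonal (2 * N),
        gaussBinomial (X ^ m) k.1 k.2 * X ^ thetaExponent m ((k.1 : ℤ) - N) := by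
  have key := prod_add_mul_pow_eq_sum_gaussBinomial ((X : (ZMod 2)⟦X⟧) ^ m) (X ^ (m * N)) X (2 * N)
  have hsum : ∑ l ∈ range N, (m * l + 1) = m * N.choose 2 + N := by
    rw [sum_add_distrib, ← mul_sum, sum_range_id, Nat.choose_two_right]; simp
  set c : ℕ := m * N.choose 2 + N + m * N * N with hc
  have hleft : ∏ l ∈ range (2 * N), ((X : (ZMod 2)⟦X⟧) ^ (m * N) + X * (X ^ m) ^ l) = X ^ c *
      ∏ l ∈ range N, (1 + (X : (ZMod 2)⟦X⟧) ^ (m * l + 1)) * (1 + X ^ (m * l + (m - 1))) := by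
    rw [two_mul, prod_range_add, prod_mul_distrib]
    have h1 : ∏ l ∈ range N, ((X : (ZMod 2)⟦X⟧) ^ (m * N) + X * (X ^ m) ^ l) =
        X ^ (m * N.choose 2 + N) * ∏ l ∈ range N, (1 + X ^ (m * l + (m - 1))) := by
      rw [← prod_range_reflect (fun l ↦ 1 + (X : (ZMod 2)⟦X⟧) ^ (m * l + (m - 1))), ← hsum,
        ← prod_pow_eq_pow_sum, ← prod_mul_distrib]
      refine prod_congr rfl fun l hl ↦ ?_
      obtain ⟨s, rfl⟩ := Nat.exists_eq_add_of_lt (mem_range.mp hl)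
      obtain ⟨m, rfl⟩ := Nat.exists_eq_add_of_le' (show 1 ≤ m by lia)
      rw [show l + s + 1 - 1 - l = s by lia, Nat.add_sub_cancel]
      ring
    have h2 : ∏ l ∈ range N, ((X : (ZMod 2)⟦X⟧) ^ (m * N) + X * (X ^ m) ^ (N + l)) =
        X ^ (m * N * N) * ∏ l ∈ range N, (1 + X ^ (m * l + 1)) := by
      have h3 : (X : (ZMod 2)⟦X⟧) ^ (m * N * N) = ∏ _l ∈ range N, X ^ (m * N) := by
        rw [prod_const, card_range, pow_mul]
      rw [h3, ← prod_mul_distrib]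
      exact prod_congr rfl fun l _ ↦ by ring
    rw [h1, h2, hc]
    ring
  have hX : (X : (ZMod 2)⟦X⟧) ^ c ≠ 0 := pow_ne_zero _ X_ne_zero
  refine mul_left_cancel₀ hX ?_
  rw [← hleft, key, mul_sum]
  refine sum_congr rfl ?_
  rintro ⟨i, j⟩ hij
  rw [HasAntidiagonal.mem_antidiagonal] at hij
  have he : m * i.choose 2 + i + m * N * j = c + thetaExponent m ((i : ℤ) - N) := by
    have h1 (n : ℕ) : 2 * (n.choose 2 : ℤ) = n * (n - 1) := by
      rw [Nat.choose_two_right]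
      have := Nat.mul_div_cancel' (Nat.even_mul_pred_self n).two_dvd
      rcases n with - | n
      · simp
      · zify at this
        simpa using this
    have hj : (j : ℤ) = 2 * N - i := by
      have : (i : ℤ) + j = 2 * N := by exact_mod_cast hij
      linarith
    have : (2 : ℤ) * (m * i.choose 2 + i + m * N * j) =
        2 * (c + thetaExponent m ((i : ℤ) - N)) := by
      rw [mul_add 2 (c : ℤ), two_mul_thetaExponent hm, hc, hj]
      push_cast
      linear_combination m * h1 i - m * h1 N
    exact_mod_cast mul_left_cancel₀ two_ne_zero this
  calc _ = gaussBinomial (X ^ m) i j * (X : (ZMod 2)⟦X⟧) ^ (m * i.choose 2 + i + m * N * j) := by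
        ring
    _ = _ := by rw [he]; ring

theorem X_pow_dvd_gaussBinomial_mul_prod_sub_one {R : Type*} [CommRing R] {m N i j : ℕ}
    (hm : 0 < m) (hi : min i j ≤ N) :
    (X : R⟦X⟧) ^ (min i j + 1) ∣
      gaussBinomial (X ^ m) i j * ∏ l ∈ range N, (1 - X ^ (m * (l + 1))) - 1 := by
  set r := min i j with hr
  let I : Ideal R⟦X⟧ := Ideal.span {X ^ (r + 1)}
  let u : R⟦X⟧ := ∏ l ∈ range r, (1 - X ^ (m * (l + 1)))
  have hu : IsUnit u := by
    rw [isUnit_iff_constantCoeff, map_prod]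
    simp [hm.ne']
  have hmk (n : ℕ) (hn : r ≤ n) :
      Ideal.Quotient.mk I (∏ l ∈ range n, (1 - X ^ (m * (l + 1)))) = Ideal.Quotient.mk I u := by
    induction n, hn using Nat.le_induction with
    | base => rfl
    | succ n hn ih =>
      have hX : Ideal.Quotient.mk I (X ^ (m * (n + 1))) = 0 :=
        Ideal.Quotient.eq_zero_iff_mem.mpr
          (Ideal.mem_span_singleton.mpr (pow_dvd_pow _ (by nlinarith)))
      rw [prod_range_succ, map_mul, ih, map_sub, map_one, hX, sub_zero, mul_one]
  have h := congrArg (Ideal.Quotient.mk I) (gaussBinomial_mul_prod_mul_prod ((X : R⟦X⟧) ^ m) i j)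
  simp only [← pow_mul] at h
  rw [map_mul, map_mul, hmk i (min_le_left _ _), hmk j (min_le_right _ _), hmk (i + j) (by lia)] at h
  rw [← Ideal.mem_span_singleton, ← Ideal.Quotient.eq, map_mul, hmk N hi, map_one]
  exact (hu.map (Ideal.Quotient.mk I)).mul_right_cancel (h.trans (one_mul _).symm)

/-- The coefficients of the finite form of the Jacobi triple product, modulo `2`. -/
theorem coeff_prod_theta_mul_prod {m N d : ℕ} (hm : 3 ≤ m) (hd : d < N) :
    coeff d ((∏ l ∈ range N, (1 + (X : (ZMod 2)⟦X⟧) ^ (m * l + 1)) * (1 + X ^ (m * l + (m - 1)))) *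
      ∏ l ∈ range N, (1 - X ^ (m * (l + 1)))) = coeff d (thetaSeries m) := by
  set Q : (ZMod 2)⟦X⟧ := ∏ l ∈ range N, (1 - X ^ (m * (l + 1))) with hQ
  rw [prod_theta_eq_sum_gaussBinomial hm, sum_mul, map_sum]
  have hterm : ∀ k ∈ antidiagonal (2 * N),
      coeff d (gaussBinomial (X ^ m) k.1 k.2 * X ^ thetaExponent m ((k.1 : ℤ) - N) * Q) =
        if d = thetaExponent m ((k.1 : ℤ) - N) then 1 else 0 := by
    rintro ⟨i, j⟩ hij
    rw [HasAntidiagonal.mem_antidiagonal] at hij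
    dsimp only at hij ⊢
    rw [← coeff_X_pow, ← sub_eq_zero, ← map_sub]
    refine X_pow_dvd_iff.mp ?_ d hd
    have h := mul_dvd_mul_left ((X : (ZMod 2)⟦X⟧) ^ thetaExponent m ((i : ℤ) - N))
      (X_pow_dvd_gaussBinomial_mul_prod_sub_one (R := ZMod 2) (m := m) (by lia)
        (show min i j ≤ N by lia))
    rw [← pow_add, ← hQ] at h
    have habs := abs_le_thetaExponent hm ((i : ℤ) - N)
    refine (pow_dvd_pow X ?_).trans (h.trans (dvd_of_eq (by ring)))
    rcases abs_cases ((i : ℤ) - N) with ⟨a, _⟩ | ⟨a, _⟩ <;> lia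
  rw [sum_congr rfl hterm]
  by_cases h : ∃ k, thetaExponent m k = d
  · obtain ⟨k, rfl⟩ := h
    have habs := abs_le_thetaExponent hm k
    have hk : |k| < N := by lia
    rw [abs_lt] at hk
    rw [coeff_thetaSeries_thetaExponent,
      sum_eq_single ((k + N).toNat, (N - k).toNat)]
    · rw [if_pos]
      congr
      lia
    · rintro ⟨i, j⟩ hij hne
      rw [HasAntidiagonal.mem_antidiagonal] at hij
      refine if_neg fun h ↦ hne ?_
      have := thetaExponent_injective hm h
      ext <;> dsimp only at * <;> lia
    · intro hk'
      rw [HasAntidiagonal.mem_antidiagonal] at hk'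
      dsimp only at hk'
      lia
  · rw [not_exists] at h
    have hz : coeff d (thetaSeries m) = 0 := by
      by_contra h'
      obtain ⟨k, hk⟩ := exists_thetaExponent_eq_of_coeff_ne_zero h'
      exact h k hk
    rw [hz]
    exact sum_eq_zero fun k _ ↦ if_neg fun h' ↦ h _ h'.symm

end Theta

section Product

open PowerSeries

/-- `j` is congruent to `0`, `1` or `-1` modulo `m`. -/
def IsThetaResidue (m j : ℕ) : Prop := m ∣ j ∨ j % m = 1 ∨ m ∣ j + 1

instance (m : ℕ) : DecidablePred (IsThetaResidue m) := fun j ↦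
  inferInstanceAs (Decidable (m ∣ j ∨ j % m = 1 ∨ m ∣ j + 1))

theorem isThetaResidue_three (j : ℕ) : IsThetaResidue 3 j := by
  unfold IsThetaResidue
  lia

theorem isThetaResidue_mul_add_succ_iff {m r : ℕ} (hm : 3 ≤ m) (hr : r < m) (N : ℕ) :
    IsThetaResidue m (m * N + r + 1) ↔ r = 0 ∨ r + 2 = m ∨ r + 1 = m := by
  have h1 : m ∣ m * N + r + 1 ↔ r + 1 = m := by
    rw [add_assoc, Nat.dvd_add_right (dvd_mul_right m N)]
    exact ⟨fun h ↦ le_antisymm (by lia) (Nat.le_of_dvd (by lia) h), fun h ↦ h ▸ dvd_rfl⟩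
  have h2 : m ∣ m * N + r + 1 + 1 ↔ r + 2 = m := by
    rw [add_assoc, add_assoc, Nat.dvd_add_right (dvd_mul_right m N)]
    refine ⟨fun h ↦ ?_, fun h ↦ h ▸ dvd_rfl⟩
    obtain ⟨k, hk⟩ := h
    have : k < 2 := by
      by_contra! h
      nlinarith
    interval_cases k <;> lia
  have h3 : (m * N + r + 1) % m = 1 ↔ r = 0 := by
    rw [add_assoc, Nat.mul_add_mod]
    rcases (show r + 1 ≤ m by lia).lt_or_eq with h | h
    · rw [Nat.mod_eq_of_lt h]
      lia
    · rw [h, Nat.mod_self]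
      lia
  rw [IsThetaResidue, h1, h2, h3]
  tauto

theorem prod_range_mul_isThetaResidue {m : ℕ} (hm : 3 ≤ m) (N : ℕ) :
    ∏ i ∈ range (m * N),
        (if IsThetaResidue m (i + 1) then 1 - (X : (ZMod 2)⟦X⟧) ^ (i + 1) else 1) =
      (∏ l ∈ range N, (1 + X ^ (m * l + 1)) * (1 + X ^ (m * l + (m - 1)))) *
        ∏ l ∈ range N, (1 - X ^ (m * (l + 1))) := by
  induction N with
  | zero => simp
  | succ N ih =>
    rw [mul_add_one, prod_range_add, ih, prod_range_succ _ N, prod_range_succ _ N]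
    have hblock : ∏ r ∈ range m, (if IsThetaResidue m (m * N + r + 1) then
          1 - (X : (ZMod 2)⟦X⟧) ^ (m * N + r + 1) else 1) =
        (1 + X ^ (m * N + 1)) * (1 + X ^ (m * N + (m - 1))) * (1 - X ^ (m * (N + 1))) := by
      rw [prod_congr rfl fun r hr ↦ if_congr
        (isThetaResidue_mul_add_succ_iff hm (mem_range.mp hr) N) rfl rfl]
      obtain ⟨m, rfl⟩ := Nat.exists_eq_add_of_le' hm
      rw [prod_range_succ, prod_range_succ, prod_range_succ', prod_eq_one]
      · have h2 : (2 : (ZMod 2)⟦X⟧) = 0 := by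
          rw [← map_ofNat (C (R := ZMod 2)) 2, show (OfNat.ofNat 2 : ZMod 2) = 0 from rfl, map_zero]
        rw [if_pos (by lia), if_pos (by lia), if_pos (by lia),
          show m + 3 - 1 = m + 2 by lia]
        linear_combination (-X ^ ((m + 3) * N + 1) - X ^ ((m + 3) * N + m + 2)) *
          (1 - X ^ ((m + 3) * N + m + 3)) * h2
      · intro r hr
        rw [mem_range] at hr
        rw [if_neg (by lia)]
    rw [hblock]
    ring

open scoped PowerSeries.WithPiTopology

theorem multipliable_ite_one_sub_X_pow (S : ℕ → Prop) [DecidablePred S] :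
    Multipliable fun i ↦ if S (i + 1) then 1 - (X : (ZMod 2)⟦X⟧) ^ (i + 1) else 1 := by
  have h := WithPiTopology.multipliable_one_add_of_tendsto_order_atTop_nhds_top (ZMod 2)
    (f := fun i ↦ if S (i + 1) then -X ^ (i + 1) else 0) ?_
  · refine h.congr fun i ↦ ?_
    split_ifs <;> simp [sub_eq_add_neg]
  · refine ENat.tendsto_nhds_top_iff_natCast_lt.mpr
      fun n ↦ Filter.eventually_atTop.mpr ⟨n, fun i hi ↦ ?_⟩
    split_ifs
    · rw [order_neg, order_X_pow]
      exact_mod_cast Nat.lt_add_one_iff.mpr hi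
    · simp

/-- The Jacobi triple product identity modulo `2`. -/
theorem tprod_isThetaResidue {m : ℕ} (hm : 3 ≤ m) :
    ∏' i, (if IsThetaResidue m (i + 1) then 1 - (X : (ZMod 2)⟦X⟧) ^ (i + 1) else 1) =
      thetaSeries m := by
  have h := (multipliable_ite_one_sub_X_pow (IsThetaResidue m)).hasProd.tendsto_prod_nat.comp
    (Filter.tendsto_id.const_mul_atTop' (show 0 < m by lia))
  refine tendsto_nhds_unique h ?_
  rw [WithPiTopology.tendsto_iff_coeff_tendsto]
  refine fun d ↦ tendsto_atTop_of_eventually_const (i₀ := d + 1) fun N hN ↦ ?_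
  rw [Function.comp_apply, id, prod_range_mul_isThetaResidue hm, coeff_prod_theta_mul_prod hm hN]

theorem powerSeriesMk_card_restricted_mul_thetaSeries {m : ℕ} (hm : 3 ≤ m) :
    PowerSeries.mk (fun n ↦ (#(Nat.Partition.restricted n (¬ IsThetaResidue m ·)) : ZMod 2)) *
      thetaSeries 3 = thetaSeries m := by
  rw [Nat.Partition.powerSeriesMk_card_restricted_eq_tprod, ← tprod_isThetaResidue le_rfl,
    ← (Nat.Partition.multipliable_powerSeriesMk_card_restricted (ZMod 2)
      (¬ IsThetaResidue m ·)).tprod_mul (multipliable_ite_one_sub_X_pow _),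
    ← tprod_isThetaResidue hm]
  refine tprod_congr fun i ↦ ?_
  rw [if_pos (isThetaResidue_three _)]
  by_cases h : IsThetaResidue m (i + 1)
  · simp [h]
  · simp_rw [h, not_false_eq_true, if_true, if_false, pow_mul]
    exact WithPiTopology.tsum_pow_mul_one_sub_of_constantCoeff_eq_zero (by simp)

end Product

section Parity

open PowerSeries

theorem coeff_thetaSeries_add_eq_zero {m d s : ℕ} (hm : 3 ≤ m) (hd : 10 * m < d) (hs : 0 < s)
    (hs2 : s ≤ 2) (h : coeff d (thetaSeries m) ≠ 0) : coeff (d + s) (thetaSeries m) = 0 := by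
  by_contra h'
  obtain ⟨k, hk⟩ := exists_thetaExponent_eq_of_coeff_ne_zero h
  obtain ⟨l, hl⟩ := exists_thetaExponent_eq_of_coeff_ne_zero h'
  have hlk : l ≠ k := by
    rintro rfl
    lia
  have habs := abs_le_two_mul_abs_thetaExponent_sub hm hlk
  rw [hk, hl, Nat.cast_add, add_sub_cancel_left, Nat.abs_cast] at habs
  have hk4 : |k| ≤ 4 := by lia
  have he := two_mul_thetaExponent hm k
  rw [hk] at he
  obtain ⟨h1, h2⟩ := abs_le.mp hk4
  interval_cases k <;> lia

theorem card_restricted_zero (S : ℕ → Prop) [DecidablePred S] :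
    #(Nat.Partition.restricted 0 S) = 1 := by
  rw [Nat.Partition.restricted, filter_true_of_mem (by simp)]
  simp

theorem card_restricted_two {S : ℕ → Prop} [DecidablePred S] (h1 : ¬ S 1) (h2 : S 2) :
    #(Nat.Partition.restricted 2 S) = 1 := by
  rw [card_eq_one]
  refine ⟨Nat.Partition.indiscrete 2, ?_⟩
  ext P
  rw [Nat.Partition.restricted, mem_filter, mem_singleton]
  refine ⟨fun ⟨_, hP⟩ ↦ ?_, fun h ↦ ⟨mem_univ _, ?_⟩⟩
  · have hparts : P.parts = Multiset.replicate P.parts.card 2 := by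
      refine Multiset.eq_replicate_card.mpr fun x hx ↦ ?_
      have hle := P.le_of_mem_parts hx
      have hpos := P.parts_pos hx
      have hS := hP x hx
      interval_cases x
      · exact absurd hS h1
      · rfl
    have hcard : P.parts.card = 1 := by
      have := congrArg Multiset.sum hparts
      rw [P.parts_sum, Multiset.sum_replicate, smul_eq_mul] at this
      lia
    ext1
    rw [hparts, hcard]
    simp
  · subst h
    simpa using h2

theorem natCast_singularOverpartition_one {p : ℕ} (hp : 2 ≤ p) (n : ℕ) :
    (singularOverpartition p 1 n : ZMod 2) =
      #(Nat.Partition.restricted n (¬ IsThetaResidue p ·)) := by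
  have hres (x : ℕ) : (x : ZMod p) = ((1 : ℕ) : ZMod p) ∨ (x : ZMod p) = -((1 : ℕ) : ZMod p) ↔
      x % p = 1 ∨ p ∣ x + 1 := by
    rw [ZMod.natCast_eq_natCast_iff', Nat.mod_eq_of_lt (show 1 < p by lia),
      eq_neg_iff_add_eq_zero, ← Nat.cast_add, ZMod.natCast_eq_zero_iff]
  let D (P : n.Partition) : Finset ℕ := P.parts.toFinset.filter fun x ↦ x % p = 1 ∨ p ∣ x + 1
  let e : {P : n.Partition × Finset ℕ //
      (∀ j ∈ P.1.parts, ¬ p ∣ j) ∧ P.2 ⊆ P.1.parts.toFinset ∧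
      ∀ x ∈ P.2, (x : ZMod p) = ((1 : ℕ) : ZMod p) ∨ (x : ZMod p) = -((1 : ℕ) : ZMod p)} ≃
      Σ P : {P : n.Partition // ∀ j ∈ P.parts, ¬ p ∣ j}, {S // S ∈ (D P).powerset} :=
    { toFun := fun P ↦ ⟨⟨P.1.1, P.2.1⟩, P.1.2, by
        rw [mem_powerset]
        exact fun x hx ↦ mem_filter.mpr ⟨P.2.2.1 hx, (hres x).mp (P.2.2.2 x hx)⟩⟩
      invFun := fun P ↦ ⟨(P.1.1, P.2.1), P.1.2,
        fun x hx ↦ (mem_filter.mp (mem_powerset.mp P.2.2 hx)).1,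
        fun x hx ↦ (hres x).mpr (mem_filter.mp (mem_powerset.mp P.2.2 hx)).2⟩
      left_inv := fun _ ↦ rfl
      right_inv := fun _ ↦ rfl }
  have hpow (P : n.Partition) : ((2 ^ #(D P) : ℕ) : ZMod 2) = if D P = ∅ then 1 else 0 := by
    split_ifs with h
    · simp [h]
    · rw [Nat.cast_pow, show ((2 : ℕ) : ZMod 2) = 0 from rfl, zero_pow (by simpa using h)]
  rw [singularOverpartition, Nat.card_congr e, Nat.card_sigma]
  simp_rw [Nat.card_eq_fintype_card, Fintype.card_coe, card_powerset]
  rw [Nat.cast_sum]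
  simp_rw [hpow]
  rw [← sum_subtype (univ.filter fun P : n.Partition ↦ ∀ j ∈ P.parts, ¬ p ∣ j) (by simp)
    (fun P ↦ if D P = ∅ then (1 : ZMod 2) else 0), sum_boole, filter_filter,
    Nat.Partition.restricted]
  congr 2
  refine filter_congr fun P _ ↦ ?_
  simp only [D, filter_eq_empty_iff, Multiset.mem_toFinset, IsThetaResidue]
  exact ⟨fun h j hj ↦ not_or.mpr ⟨h.1 j hj, h.2 hj⟩,
    fun h ↦ ⟨fun j hj ↦ (not_or.mp (h j hj)).1, fun j hj ↦ (not_or.mp (h j hj)).2⟩⟩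

/-- A series `∑ f n X ^ n` with `f 0 = f 2 = 1` whose product with the pentagonal series is a theta
series cannot have all but finitely many coefficients equal to `1`. -/
theorem exists_gt_ne_one_of_mul_thetaSeries_eq {m : ℕ} (hm : 3 ≤ m) {f : ℕ → ZMod 2}
    (hf : PowerSeries.mk f * thetaSeries 3 = thetaSeries m) (h0 : f 0 = 1) (h2 : f 2 = 1) (B : ℕ) :
    ∃ n > B, f n ≠ 1 := by
  by_contra! hB
  set M := B + 10 * m + 20 with hM
  set ω := thetaExponent 3 (2 * M : ℕ) with hω
  have hωM : 2 * M ≤ ω := by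
    have := abs_le_thetaExponent le_rfl (2 * M : ℕ)
    rw [Nat.abs_cast] at this
    exact_mod_cast this
  have hω1 : coeff ω (thetaSeries 3) = 1 := coeff_thetaSeries_thetaExponent _ _
  have hfar (b : ℕ) (hb : coeff b (thetaSeries 3) ≠ 0) (hbω : b ≠ ω) :
      (M : ℤ) ≤ |(b : ℤ) - ω| := by
    obtain ⟨k, rfl⟩ := exists_thetaExponent_eq_of_coeff_ne_zero hb
    have := abs_le_two_mul_abs_thetaExponent_sub le_rfl
      (show k ≠ (2 * M : ℕ) from fun h ↦ hbω (h ▸ rfl))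
    rw [← hω, Nat.abs_cast] at this
    push_cast at this
    linarith
  have hconv (d : ℕ) : coeff d (thetaSeries m) =
      ∑ b ∈ range (d + 1), coeff b (thetaSeries 3) * f (d - b) := by
    rw [← hf, mul_comm, coeff_mul,
      ← Nat.sum_antidiagonal_eq_sum_range_succ (fun i j ↦ coeff i (thetaSeries 3) * f j)]
    simp
  set c := ∑ b ∈ range ω, coeff b (thetaSeries 3)
  have hterm (d b : ℕ) (hd : ω ≤ d + 2) (hb : b < ω) :
      coeff b (thetaSeries 3) * f (d - b) = coeff b (thetaSeries 3) := by
    by_cases h : coeff b (thetaSeries 3) = 0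
    · simp [h]
    · have := hfar b h hb.ne
      rw [abs_of_neg (by lia)] at this
      rw [hB _ (by lia), mul_one]
  have hge (i : ℕ) (hi : i ≤ 2) : coeff (ω + i) (thetaSeries m) = c + f i := by
    have hz : ∑ l ∈ range i,
        coeff (ω + (l + 1)) (thetaSeries 3) * f (ω + i - (ω + (l + 1))) = 0 := by
      refine sum_eq_zero fun l hl ↦ ?_
      rw [mem_range] at hl
      by_cases h : coeff (ω + (l + 1)) (thetaSeries 3) = 0
      · simp [h]
      · have := hfar _ h (by lia)
        rw [abs_of_pos (by lia)] at this
        lia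
    rw [hconv, add_assoc, sum_range_add,
      sum_congr rfl fun b hb ↦ hterm (ω + i) b (by lia) (mem_range.mp hb), sum_range_succ' _ i,
      hz, zero_add, add_zero, hω1, Nat.add_sub_cancel_left, one_mul]
  have hlt (s : ℕ) (hs : 0 < s) (hs2 : s ≤ 2) : coeff (ω - s) (thetaSeries m) = c := by
    rw [hconv, sum_congr rfl fun b hb ↦
      hterm (ω - s) b (by lia) (by have := mem_range.mp hb; lia)]
    refine sum_subset (range_subset_range.mpr (by lia)) fun b hb hb' ↦ ?_
    rw [mem_range] at hb hb'
    by_contra h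
    have := hfar b h hb.ne
    rw [abs_of_neg (by lia)] at this
    lia
  rcases (show ∀ x : ZMod 2, x = 0 ∨ x = 1 by decide) c with hc0 | hc1
  · have h := coeff_thetaSeries_add_eq_zero hm (d := ω) (s := 2) (by lia) two_pos le_rfl
      (by rw [← add_zero ω, hge 0 (by lia), hc0, h0]; decide)
    rw [hge 2 le_rfl, hc0, h2] at h
    exact absurd h (by decide)
  · have h := coeff_thetaSeries_add_eq_zero hm (d := ω - 2) (s := 1) (by lia) one_pos (by lia)
      (by rw [hlt 2 two_pos le_rfl, hc1]; decide)
    rw [show ω - 2 + 1 = ω - 1 by lia, hlt 1 one_pos (by lia), hc1] at h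
    exact absurd h (by decide)

end Parity

theorem stmt_1 (p : ℕ) (hp : p.Prime) (hp5 : 5 ≤ p) :
    {n : ℕ | 0 < n ∧ Even (singularOverpartition p 1 n)}.Infinite := by
  have h1 : IsThetaResidue p 1 := Or.inr (Or.inl (Nat.mod_eq_of_lt (by lia)))
  have h2 : ¬ IsThetaResidue p 2 := by
    rintro (h | h | h)
    · exact absurd (Nat.le_of_dvd two_pos h) (by lia)
    · rw [Nat.mod_eq_of_lt (by lia)] at h
      lia
    · exact absurd (Nat.le_of_dvd three_pos h) (by lia)
  refine Set.infinite_of_forall_exists_gt fun B ↦ ?_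
  obtain ⟨n, hn, hne⟩ := exists_gt_ne_one_of_mul_thetaSeries_eq (by lia)
    (powerSeriesMk_card_restricted_mul_thetaSeries (show 3 ≤ p by lia))
    (by rw [card_restricted_zero, Nat.cast_one])
    (by rw [card_restricted_two (not_not.mpr h1) h2, Nat.cast_one]) B
  refine ⟨n, ⟨by lia, ?_⟩, hn⟩
  rw [← natCast_singularOverpartition_one (by lia), Ne, ZMod.natCast_eq_one_iff_odd] at hne
  exact Nat.not_odd_iff_even.mp hne
end

section
/- For every prime p ≥ 5 there exists a constant α > 0 such that for all sufficiently large real numbers X, the number of integers n with 1 ≤ n ≤ X and C̄_{p,1}(n) even is at least α·log(log X). -/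
open Finset

/-- The finite `q`-Pochhammer product `(1 - Q) (1 - Q ^ 2) ⋯ (1 - Q ^ n)`. -/
def qPochhammer {R : Type*} [CommRing R] (Q : R) (n : ℕ) : R :=
  ∏ i ∈ range n, (1 - Q ^ (i + 1))

/-- The Gaussian binomial coefficient, defined by its Pascal recursion. -/
def qBinom {R : Type*} [CommRing R] (Q : R) : ℕ → ℕ → R
  | _, 0 => 1
  | 0, _ + 1 => 0
  | n + 1, k + 1 => qBinom Q n (k + 1) + Q ^ (n - k) * qBinom Q n k

section QBinom

variable {R : Type*} [CommRing R]

theorem qPochhammer_succ (Q : R) (n : ℕ) :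
    qPochhammer Q (n + 1) = qPochhammer Q n * (1 - Q ^ (n + 1)) :=
  prod_range_succ _ _

theorem qBinom_zero_right (Q : R) (n : ℕ) : qBinom Q n 0 = 1 := by
  cases n <;> rfl

theorem qBinom_succ_succ (Q : R) (n k : ℕ) :
    qBinom Q (n + 1) (k + 1) = qBinom Q n (k + 1) + Q ^ (n - k) * qBinom Q n k := rfl

theorem qBinom_eq_zero_of_lt (Q : R) {n k : ℕ} (h : n < k) : qBinom Q n k = 0 := by
  induction n generalizing k with
  | zero =>
    obtain ⟨k, rfl⟩ := Nat.exists_eq_succ_of_ne_zero h.ne'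
    rfl
  | succ n ih =>
    obtain ⟨k, rfl⟩ := Nat.exists_eq_succ_of_ne_zero (Nat.ne_zero_of_lt h)
    rw [Nat.succ_eq_add_one, qBinom_succ_succ, ih (by omega), ih (by omega)]
    simp

theorem qBinom_mul_qPochhammer (Q : R) (a b : ℕ) :
    qBinom Q (a + b) a * (qPochhammer Q a * qPochhammer Q b) = qPochhammer Q (a + b) := by
  induction h : a + b generalizing a b with
  | zero =>
    obtain ⟨rfl, rfl⟩ : a = 0 ∧ b = 0 := by omega
    simp [qBinom_zero_right, qPochhammer]
  | succ n ih =>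
    rcases a with _ | a
    · obtain rfl : b = n + 1 := by omega
      simp [qBinom_zero_right, qPochhammer]
    rw [qBinom_succ_succ]
    have h2 := ih a b (by omega)
    rcases b with _ | b
    · obtain rfl : a = n := by omega
      rw [qBinom_eq_zero_of_lt Q (Nat.lt_succ_self a), qPochhammer_succ]
      simp only [Nat.sub_self, pow_zero, one_mul, zero_add]
      linear_combination (1 - Q ^ (a + 1)) * h2
    · have h1 := ih (a + 1) b (by omega)
      have hs : n - a = b + 1 := by omega
      have hn : n = a + b + 1 := by omega
      rw [hs, qPochhammer_succ Q n]
      rw [qPochhammer_succ Q b] at h2 ⊢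
      rw [qPochhammer_succ Q a] at h1 ⊢
      have hQ : Q ^ (n + 1) = Q ^ (a + 1) * Q ^ (b + 1) := by rw [← pow_add]; congr 1; omega
      rw [hQ]
      linear_combination (1 - Q ^ (b + 1)) * h1 + Q ^ (b + 1) * (1 - Q ^ (a + 1)) * h2

/-- The homogeneous `q`-binomial theorem. -/
theorem prod_add_mul_pow_eq_sum_qBinom (Q x y : R) (n : ℕ) :
    ∏ i ∈ range n, (x + y * Q ^ i) =
      ∑ j ∈ range (n + 1), Q ^ j.choose 2 * qBinom Q n j * y ^ j * x ^ (n - j) := by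
  induction n with
  | zero => simp [qBinom_zero_right]
  | succ n ih =>
    rw [prod_range_succ, ih, sum_range_succ' _ (n + 1)]
    have key : ∑ j ∈ range (n + 1), Q ^ (j + 1).choose 2 * qBinom Q n (j + 1) * y ^ (j + 1) *
        x ^ (n - j) + x ^ (n + 1) =
        x * ∑ j ∈ range (n + 1), Q ^ j.choose 2 * qBinom Q n j * y ^ j * x ^ (n - j) := by
      rw [sum_range_succ, sum_range_succ', qBinom_eq_zero_of_lt Q (Nat.lt_succ_self n), mul_add,
        mul_sum]
      simp only [qBinom_zero_right]
      have : ∀ j ∈ range n, Q ^ (j + 1).choose 2 * qBinom Q n (j + 1) * y ^ (j + 1) * x ^ (n - j)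
          = x * (Q ^ (j + 1).choose 2 * qBinom Q n (j + 1) * y ^ (j + 1) * x ^ (n - (j + 1))) := by
        intro j hj
        have : n - j = (n - (j + 1)) + 1 := by have := mem_range.mp hj; omega
        rw [this, pow_succ]
        ring
      rw [sum_congr rfl this]
      simp [pow_succ']
    have key2 : ∀ j ∈ range (n + 1),
        Q ^ (j + 1).choose 2 * qBinom Q (n + 1) (j + 1) * y ^ (j + 1) * x ^ (n + 1 - (j + 1)) =
        Q ^ (j + 1).choose 2 * qBinom Q n (j + 1) * y ^ (j + 1) * x ^ (n - j) +
        Q ^ j.choose 2 * qBinom Q n j * y ^ j * x ^ (n - j) * (y * Q ^ n) := by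
      intro j hj
      have h1 : Q ^ n = Q ^ j * Q ^ (n - j) := by
        rw [← pow_add]; congr 1; have := mem_range.mp hj; omega
      have h2 : (j + 1).choose 2 = j + j.choose 2 := by
        rw [Nat.choose_succ_succ' j 1, Nat.choose_one_right]
      rw [qBinom_succ_succ, h1, h2, pow_add, Nat.add_sub_add_right]
      ring
    rw [sum_congr rfl key2, sum_add_distrib, ← sum_mul]
    simp only [qBinom_zero_right, Nat.choose_zero_succ, pow_zero, mul_one, one_mul, Nat.sub_zero]
    linear_combination -key

/-- Modulo `Q ^ (m + 1)`, the product `qPochhammer Q n` is constant for `n ≥ m`. -/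
theorem pow_dvd_qPochhammer_sub (Q : R) {m n : ℕ} (h : m ≤ n) :
    Q ^ (m + 1) ∣ qPochhammer Q n - qPochhammer Q m := by
  induction n, h using Nat.le_induction with
  | base => simp
  | succ n hn ih =>
    have : qPochhammer Q (n + 1) - qPochhammer Q m =
        (qPochhammer Q n - qPochhammer Q m) - Q ^ (n + 1) * qPochhammer Q n := by
      rw [qPochhammer_succ]; ring
    rw [this]
    exact dvd_sub ih (Dvd.dvd.mul_right (pow_dvd_pow _ (by omega)) _)

theorem pow_dvd_qBinom_mul_qPochhammer_sub_one (Q : R) {m a b c : ℕ} (ha : m ≤ a) (hb : m ≤ b)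
    (hc : m ≤ c) (hu : IsUnit (qPochhammer Q m)) :
    Q ^ (m + 1) ∣ qBinom Q (a + b) a * qPochhammer Q c - 1 := by
  obtain ⟨A, hA⟩ := pow_dvd_qPochhammer_sub Q ha
  obtain ⟨B, hB⟩ := pow_dvd_qPochhammer_sub Q hb
  obtain ⟨C, hC⟩ := pow_dvd_qPochhammer_sub Q hc
  obtain ⟨D, hD⟩ := pow_dvd_qPochhammer_sub Q (le_add_right ha : m ≤ a + b)
  have h := qBinom_mul_qPochhammer Q a b
  rw [← hu.dvd_mul_left]
  rw [sub_eq_iff_eq_add] at hA hB hC hD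
  rw [hA, hB, hD] at h
  rw [hC]
  generalize qBinom Q (a + b) a = β at *
  generalize Q ^ (m + 1) = ε at *
  generalize qPochhammer Q m = u at *
  exact ⟨D + u * β * C - β * (A * B * ε + (A + B) * u), by linear_combination h⟩

end QBinom

section Theta

open PowerSeries

variable {R : Type*} [CommRing R]

theorem X_pow_mul_prod_eq_sum_qBinom {p : ℕ} (hp : 0 < p) (N : ℕ) :
    (X : R⟦X⟧) ^ (p * N.choose 2 + N + p * N * N) *
      ∏ l ∈ range N, ((1 + X ^ (p * l + 1)) * (1 + X ^ (p * l + (p - 1)))) =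
      ∑ j ∈ range (2 * N + 1),
        X ^ (p * j.choose 2 + j + p * N * (2 * N - j)) * qBinom (X ^ p) (2 * N) j := by
  have h := prod_add_mul_pow_eq_sum_qBinom ((X : R⟦X⟧) ^ p) ((X ^ p) ^ N) X (2 * N)
  have hr : ∀ j ∈ range (2 * N + 1),
      ((X : R⟦X⟧) ^ p) ^ j.choose 2 * qBinom (X ^ p) (2 * N) j * X ^ j *
        ((X ^ p) ^ N) ^ (2 * N - j) =
      X ^ (p * j.choose 2 + j + p * N * (2 * N - j)) * qBinom (X ^ p) (2 * N) j := by
    intro j _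
    simp only [← pow_mul, pow_add]
    ring
  rw [sum_congr rfl hr] at h
  rw [← h, two_mul, prod_range_add, prod_mul_distrib]
  have hX : ∀ n : ℕ, (X : R⟦X⟧) ^ (p * n.choose 2 + n) = ∏ i ∈ range n, X ^ (p * i + 1) := by
    intro n
    induction n with
    | zero => simp
    | succ n ih =>
      rw [prod_range_succ, ← ih, ← pow_add, Nat.choose_succ_succ' n 1, Nat.choose_one_right]
      congr 1
      ring
  have h1 : ∏ i ∈ range N, (((X : R⟦X⟧) ^ p) ^ N + X * (X ^ p) ^ i) =
      X ^ (p * N.choose 2 + N) * ∏ l ∈ range N, (1 + X ^ (p * l + (p - 1))) := by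
    rw [← prod_range_reflect (fun l => 1 + (X : R⟦X⟧) ^ (p * l + (p - 1))), hX,
      ← prod_mul_distrib]
    refine prod_congr rfl fun i hi => ?_
    have hi := mem_range.mp hi
    have hN : p * N = (p * i + 1) + (p * (N - 1 - i) + (p - 1)) := by
      obtain ⟨d, rfl⟩ := Nat.exists_eq_add_of_lt hi
      rw [show i + d + 1 - 1 - i = d by omega]
      have : p * (i + d + 1) = p * i + p * d + p := by ring
      omega
    rw [mul_add, mul_one, ← pow_add, ← hN, ← pow_mul, ← pow_mul]
    ring
  have h2 : ∏ i ∈ range N, (((X : R⟦X⟧) ^ p) ^ N + X * (X ^ p) ^ (N + i)) =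
      X ^ (p * N * N) * ∏ l ∈ range N, (1 + X ^ (p * l + 1)) := by
    have hc : ((X : R⟦X⟧) ^ (p * N * N)) = ∏ _i ∈ range N, X ^ (p * N) := by
      rw [prod_const, card_range, ← pow_mul]
    rw [hc, ← prod_mul_distrib]
    refine prod_congr rfl fun i _ => ?_
    simp only [← pow_mul, ← pow_succ', mul_add, mul_one, ← pow_add]
    congr 2
  rw [h1, h2, pow_add]
  ring

theorem isUnit_qPochhammer_X_pow {p : ℕ} (hp : 0 < p) (n : ℕ) :
    IsUnit (qPochhammer ((X : R⟦X⟧) ^ p) n) := by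
  rw [isUnit_iff_constantCoeff]
  simp [qPochhammer, map_prod, hp.ne']

/-- The exponents occurring in the theta series attached to `p` are of the form
`k (p k - (p - 2)) / 2`. -/
theorem exists_of_coeff_prod_ne_zero {p : ℕ} (hp : 5 ≤ p) {M N : ℕ} (hN : 2 * M + 2 ≤ N)
    (h : coeff M ((∏ l ∈ range N, ((1 + X ^ (p * l + 1)) * (1 + X ^ (p * l + (p - 1))))) *
      qPochhammer ((X : R⟦X⟧) ^ p) N) ≠ 0) :
    ∃ k : ℤ, 2 * (M : ℤ) = k * (p * k - (p - 2)) := by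
  have hid := X_pow_mul_prod_eq_sum_qBinom (R := R) (by omega : 0 < p) N
  set e₀ := p * N.choose 2 + N + p * N * N with he₀
  set e : ℕ → ℕ := fun j => p * j.choose 2 + j + p * N * (2 * N - j) with he
  rw [← coeff_X_pow_mul _ e₀ M, ← mul_assoc, hid, sum_mul, map_sum] at h
  obtain ⟨j, hj, hne⟩ := exists_ne_zero_of_sum_ne_zero h
  have hj : j ≤ 2 * N := by have := mem_range.mp hj; omega
  change coeff (M + e₀) (X ^ (e j) * qBinom (X ^ p) (2 * N) j * qPochhammer (X ^ p) N) ≠ 0 at hne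
  have hch : ∀ n : ℕ, 2 * ((n.choose 2 : ℕ) : ℤ) = n * (n - 1) := by
    intro n
    induction n with
    | zero => simp
    | succ n ih =>
      rw [Nat.choose_succ_succ' n 1, Nat.choose_one_right]
      push_cast
      linarith
  obtain ⟨k, hk⟩ : ∃ k : ℤ, (j : ℤ) = N + k := ⟨j - N, by ring⟩
  have hexp : 2 * ((e j : ℕ) : ℤ) = 2 * (e₀ : ℤ) + k * (p * k - (p - 2)) := by
    simp only [he, he₀]
    push_cast [Nat.cast_sub hj]
    have h1 := hch j
    have h2 := hch N
    rw [hk] at h1 ⊢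
    linear_combination (p : ℤ) * h1 - (p : ℤ) * h2
  have hp' : (5 : ℤ) ≤ p := by exact_mod_cast hp
  have hpos : 0 ≤ k * (p * k - (p - 2)) := by
    rcases lt_trichotomy k 0 with h0 | h0 | h0
    · exact mul_nonneg_of_nonpos_of_nonpos h0.le (by nlinarith)
    · simp [h0]
    · exact mul_nonneg h0.le (by nlinarith)
  have hle₀ : e₀ ≤ e j := by zify; linarith
  rw [mul_assoc, coeff_X_pow_mul'] at hne
  split_ifs at hne with hle
  · refine ⟨k, ?_⟩
    suffices M + e₀ = e j by
      have : ((M + e₀ : ℕ) : ℤ) = e j := by exact_mod_cast this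
      push_cast at this
      linarith
    have hle' : k * (p * k - (p - 2)) ≤ 2 * (M : ℤ) := by
      have : ((e j : ℕ) : ℤ) ≤ ((M + e₀ : ℕ) : ℤ) := by exact_mod_cast hle
      push_cast at this
      linarith
    have hk1 : k ≤ M + 1 := by
      by_contra! hc
      nlinarith [mul_le_mul hp' (by linarith : (M : ℤ) + 1 ≤ k - 1) (by positivity) (by positivity)]
    have hk2 : -(M + 1 : ℤ) ≤ k := by
      by_contra! hc
      nlinarith [mul_le_mul hp' (by linarith : (M : ℤ) + 1 ≤ - k) (by positivity) (by positivity)]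
    have hjM : M ≤ j := by omega
    have hjM' : M ≤ 2 * N - j := by omega
    have hdvd := pow_dvd_qBinom_mul_qPochhammer_sub_one ((X : R⟦X⟧) ^ p) hjM hjM'
      (by omega : M ≤ N) (isUnit_qPochhammer_X_pow (by omega) M)
    rw [Nat.add_sub_cancel' hj, ← pow_mul] at hdvd
    have hlt : M + e₀ - e j < p * (M + 1) :=
      lt_of_le_of_lt (by omega : _ ≤ M) (by nlinarith)
    have hz := X_pow_dvd_iff.mp hdvd _ hlt
    rw [map_sub, sub_eq_zero] at hz
    rw [hz, coeff_one] at hne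
    by_contra hcon
    exact hne (if_neg (by omega))
  · exact absurd rfl hne

end Theta

section Parity

open PowerSeries
open scoped PowerSeries.WithPiTopology

theorem cast_singularOverpartition_eq (p n : ℕ) :
    (singularOverpartition p 1 n : ZMod 2) =
      ((Nat.Partition.restricted n fun j => ¬ p ∣ j ∧ ¬ p ∣ j + 1 ∧ j % p ≠ 1 % p).card : ZMod 2) := by
  classical
  let c : ℕ → Prop := fun x => (x : ZMod p) = ((1 : ℕ) : ZMod p) ∨ (x : ZMod p) = -((1 : ℕ) : ZMod p)
  have hc (x : ℕ) : c x ↔ ¬ (¬ p ∣ x + 1 ∧ x % p ≠ 1 % p) := by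
    simp only [c]
    rw [ZMod.natCast_eq_natCast_iff', eq_neg_iff_add_eq_zero, ← Nat.cast_add,
      ZMod.natCast_eq_zero_iff]
    tauto
  let e : {P : n.Partition × Finset ℕ // (∀ j ∈ P.1.parts, ¬ p ∣ j) ∧
      P.2 ⊆ P.1.parts.toFinset ∧ ∀ x ∈ P.2, c x} ≃
      Σ l : {l : n.Partition // ∀ j ∈ l.parts, ¬ p ∣ j},
        {S : Finset ℕ // S ∈ (l.1.parts.toFinset.filter c).powerset} :=
    { toFun := fun P => ⟨⟨P.1.1, P.2.1⟩, ⟨P.1.2, by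
        rw [mem_powerset]
        exact fun x hx => mem_filter.mpr ⟨P.2.2.1 hx, P.2.2.2 x hx⟩⟩⟩
      invFun := fun P => ⟨(P.1.1, P.2.1), P.1.2,
        fun x hx => (mem_filter.mp (mem_powerset.mp P.2.2 hx)).1,
        fun x hx => (mem_filter.mp (mem_powerset.mp P.2.2 hx)).2⟩
      left_inv := fun _ => rfl
      right_inv := fun _ => rfl }
  have h1 : singularOverpartition p 1 n =
      ∑ l : {l : n.Partition // ∀ j ∈ l.parts, ¬ p ∣ j},
        2 ^ (l.1.parts.toFinset.filter c).card := by
    rw [singularOverpartition, Nat.card_congr e, Nat.card_eq_fintype_card, Fintype.card_sigma]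
    simp only [Fintype.card_coe, card_powerset]
  rw [h1, Nat.cast_sum, Nat.Partition.restricted, card_filter, Nat.cast_sum,
    ← sum_subtype (univ.filter fun l : n.Partition => ∀ j ∈ l.parts, ¬ p ∣ j) (by simp)
      (fun l : n.Partition => ((2 ^ (l.parts.toFinset.filter c).card : ℕ) : ZMod 2)), sum_filter]
  refine sum_congr rfl fun l _ => ?_
  have h2 : (2 : ZMod 2) = 0 := rfl
  by_cases hd : ∀ j ∈ l.parts, ¬ p ∣ j
  · rw [if_pos hd]
    by_cases hg : ∀ j ∈ l.parts, ¬ p ∣ j ∧ ¬ p ∣ j + 1 ∧ j % p ≠ 1 % p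
    · have : l.parts.toFinset.filter c = ∅ :=
        filter_eq_empty_iff.mpr fun x hx hcx =>
          (hc x).mp hcx (hg x (Multiset.mem_toFinset.mp hx)).2
      rw [if_pos hg, this]
      simp
    · have : (l.parts.toFinset.filter c).card ≠ 0 := by
        push Not at hg
        obtain ⟨x, hx, hx'⟩ := hg
        refine card_ne_zero_of_mem (a := x) (mem_filter.mpr ⟨Multiset.mem_toFinset.mpr hx, ?_⟩)
        exact (hc x).mpr fun h => h.2 (hx' (hd x hx) h.1)
      rw [if_neg hg]
      push_cast
      rw [h2, zero_pow this]
  · rw [if_neg hd, if_neg fun h => hd fun j hj => (h j hj).1]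
    simp

theorem prod_range_mul_eq {R : Type*} [CommRing R] [CharP R 2] {p : ℕ} (hp : 5 ≤ p) (N : ℕ) :
    ∏ i ∈ range (p * N), (if ¬ p ∣ i + 1 ∧ ¬ p ∣ i + 1 + 1 ∧ (i + 1) % p ≠ 1 % p then 1
      else 1 - (X : R⟦X⟧) ^ (i + 1)) =
    (∏ l ∈ range N, ((1 + X ^ (p * l + 1)) * (1 + X ^ (p * l + (p - 1))))) *
      qPochhammer ((X : R⟦X⟧) ^ p) N := by
  have hneg : ∀ a : R⟦X⟧, 1 - a = 1 + a := fun a => by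
    have h2 : (2 : R⟦X⟧) = 0 := by
      rw [← map_ofNat (C (R := R)), CharTwo.two_eq_zero, map_zero]
    linear_combination (-a) * h2
  induction N with
  | zero => simp [qPochhammer]
  | succ N ih =>
    rw [mul_add, mul_one, prod_range_add, ih, prod_range_succ, qPochhammer_succ]
    obtain ⟨q, rfl⟩ : ∃ q, p = q + 3 := ⟨p - 3, by omega⟩
    have hmid : ∀ b ∈ range q, (if ¬ q + 3 ∣ (q + 3) * N + (b + 1) + 1 ∧
        ¬ q + 3 ∣ (q + 3) * N + (b + 1) + 1 + 1 ∧
        ((q + 3) * N + (b + 1) + 1) % (q + 3) ≠ 1 % (q + 3) then 1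
        else 1 - (X : R⟦X⟧) ^ ((q + 3) * N + (b + 1) + 1)) = 1 := by
      intro b hb
      have hb := mem_range.mp hb
      have hmod : ∀ c, ((q + 3) * N + c) % (q + 3) = c % (q + 3) := fun c => Nat.mul_add_mod _ _ _
      rw [if_pos]
      simp only [Nat.dvd_iff_mod_eq_zero, add_assoc, hmod]
      rw [Nat.mod_eq_of_lt (by omega), Nat.mod_eq_of_lt (by omega), Nat.mod_eq_of_lt (by omega)]
      omega
    rw [prod_range_succ _ (q + 2), prod_range_succ _ (q + 1), prod_range_succ', prod_eq_one hmid]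
    have h1 : (q + 3) ∣ (q + 3) * N + (q + 2) + 1 := ⟨N + 1, by ring⟩
    have h2 : (q + 3) ∣ (q + 3) * N + (q + 1) + 1 + 1 := ⟨N + 1, by ring⟩
    have h3 : ((q + 3) * N + 0 + 1) % (q + 3) = 1 % (q + 3) := by
      rw [add_zero, Nat.mul_add_mod]
    rw [if_neg (fun h => h.2.2 h3), if_neg (fun h => h.2.1 h2), if_neg (fun h => h.1 h1),
      ← hneg, ← hneg, ← pow_mul]
    have e1 : (q + 3) * N + (q + 2) + 1 = (q + 3) * (N + 1) := by ring
    have e2 : (q + 3) * N + (q + 1) + 1 = (q + 3) * N + (q + 3 - 1) := by omega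
    rw [e1, e2, add_zero]
    ring

/-- The product of the generating function with Euler's product is the theta product. -/
theorem hasProd_mk_mul_pentagonalSeries (K : Type*) [Field K] [TopologicalSpace K]
    [T2Space K] [IsTopologicalRing K] (c : ℕ → Prop) [DecidablePred c] :
    HasProd (fun i => if c (i + 1) then 1 else 1 - (X : K⟦X⟧) ^ (i + 1))
      ((PowerSeries.mk fun n => ((Nat.Partition.restricted n c).card : K)) *
        pentagonalSeries K) := by
  have h := (Nat.Partition.hasProd_powerSeriesMk_card_restricted K c).mul
    (PowerSeries.WithPiTopology.hasProd_one_sub_X_pow K)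
  refine h.congr_fun fun i => ?_
  split_ifs
  · simp_rw [pow_mul]
    rw [PowerSeries.WithPiTopology.tsum_pow_mul_one_sub_of_constantCoeff_eq_zero (by simp)]
  · rw [one_mul]

/-- Modulo `2`, the convolution of the counting function with the pentagonal numbers is
supported on the numbers `k (p k - (p - 2)) / 2`. -/
theorem exists_of_coeff_mul_pentagonalSeries_ne_zero {p : ℕ} (hp : 5 ≤ p) {n : ℕ}
    (h : coeff n ((PowerSeries.mk fun n => (singularOverpartition p 1 n : ZMod 2)) *
      pentagonalSeries (ZMod 2)) ≠ 0) :
    ∃ k : ℤ, 2 * (n : ℤ) = k * (p * k - (p - 2)) := by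
  let _ : TopologicalSpace (ZMod 2) := ⊥
  have _ : DiscreteTopology (ZMod 2) := ⟨rfl⟩
  have hprod := (hasProd_mk_mul_pentagonalSeries (ZMod 2)
    (fun j => ¬ p ∣ j ∧ ¬ p ∣ j + 1 ∧ j % p ≠ 1 % p))
  simp only [← cast_singularOverpartition_eq] at hprod
  rw [HasProd, PowerSeries.WithPiTopology.tendsto_iff_coeff_tendsto] at hprod
  have h2 := hprod n
  rw [nhds_discrete, Filter.tendsto_pure] at h2
  have h3 := Filter.tendsto_finset_range.eventually h2
  obtain ⟨N₀, hN₀⟩ := Filter.eventually_atTop.mp h3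
  have h4 := hN₀ (p * (N₀ + 2 * n + 2)) (by nlinarith)
  rw [prod_range_mul_eq hp] at h4
  rw [← h4] at h
  exact exists_of_coeff_prod_ne_zero hp (by omega) h

end Parity

section EvenValues

open PowerSeries

/-- There are `2 k + 1` generalized pentagonal numbers up to any `n` between `pentagonal (-k)`
and `pentagonal (k + 1)`. -/
theorem filter_mem_range_pentagonal_eq [DecidablePred (· ∈ Set.range pentagonal)] {k n : ℕ}
    (h1 : pentagonal (-k) ≤ n) (h2 : n < pentagonal (k + 1)) :
    (range (n + 1)).filter (· ∈ Set.range pentagonal) = (Icc (-k : ℤ) k).image pentagonal := by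
  ext j
  simp only [mem_filter, mem_range, Set.mem_range, mem_image, mem_Icc]
  have e1 := two_mul_natCast_pentagonal_neg k
  have e2 := two_mul_natCast_pentagonal (k + 1)
  zify at h1 h2
  constructor
  · rintro ⟨hj, z, rfl⟩
    refine ⟨z, ?_, rfl⟩
    have e3 := two_mul_natCast_pentagonal z
    have hj' : (pentagonal z : ℤ) ≤ n := by exact_mod_cast Nat.lt_succ_iff.mp hj
    constructor <;> by_contra! hc <;> nlinarith
  · rintro ⟨z, ⟨hz1, hz2⟩, rfl⟩
    refine ⟨?_, z, rfl⟩
    have e3 := two_mul_natCast_pentagonal z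
    zify
    nlinarith [mul_nonneg (by linarith : 0 ≤ (k : ℤ) - z) (by linarith : 0 ≤ (k : ℤ) + z)]

theorem coeff_mul_pentagonalSeries_eq_one {f : ℕ → ZMod 2} {k m n : ℕ}
    (h1 : pentagonal (-k) + m < n) (h2 : n < pentagonal (k + 1))
    (hf : ∀ i, m < i → i ≤ n → f i = 1) :
    coeff n (PowerSeries.mk f * pentagonalSeries (ZMod 2)) = 1 := by
  classical
  have himage := filter_mem_range_pentagonal_eq (by omega : pentagonal (-k) ≤ n) h2
  rw [mul_comm, coeff_mul, Nat.sum_antidiagonal_eq_sum_range_succ_mk]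
  have hterm : ∀ j ∈ range n.succ, coeff j (pentagonalSeries (ZMod 2)) *
      coeff (n - j) (PowerSeries.mk f) = if j ∈ Set.range pentagonal then 1 else 0 := by
    intro j hj
    split_ifs with hr
    · have hmem : j ∈ (Icc (-k : ℤ) k).image pentagonal :=
        himage ▸ mem_filter.mpr ⟨hj, hr⟩
      obtain ⟨z, hz, rfl⟩ := mem_image.mp hmem
      obtain ⟨hz1, hz2⟩ := mem_Icc.mp hz
      have hle : pentagonal z ≤ pentagonal (-k) := by
        have e1 := two_mul_natCast_pentagonal_neg k
        have e3 := two_mul_natCast_pentagonal z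
        zify
        nlinarith [mul_nonneg (by linarith : 0 ≤ (k : ℤ) - z) (by linarith : 0 ≤ (k : ℤ) + z)]
      rw [coeff_mk, hf _ (by omega) (by omega), mul_one, coeff_pentagonalSeries_pentagonal]
      rcases Int.even_or_odd z with h | h
      · simp [Int.negOnePow_even z h]
      · simp [Int.negOnePow_odd z h]
    · rw [coeff_pentagonalSeries_eq_zero _ hr, zero_mul]
  rw [sum_congr rfl hterm, ← sum_filter, himage, sum_const,
    card_image_of_injective _ pentagonal_injective, Int.card_Icc]
  have : ((k : ℤ) + 1 - -k).toNat = 2 * k + 1 := by omega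
  rw [this, nsmul_eq_mul, mul_one]
  push_cast
  rw [show (2 : ZMod 2) = 0 from rfl, zero_mul, zero_add]

theorem not_exists_and_exists_succ {p n : ℕ} (hp : 5 ≤ p) (hn : 8 * p ≤ n) {k l : ℤ}
    (hk : 2 * (n : ℤ) = k * (p * k - (p - 2)))
    (hl : 2 * ((n + 1 : ℕ) : ℤ) = l * (p * l - (p - 2))) : False := by
  push_cast at hl
  have hp' : (5 : ℤ) ≤ p := by exact_mod_cast hp
  have hn' : 8 * (p : ℤ) ≤ n := by exact_mod_cast hn
  set a := |2 * p * k - (p - 2)| with ha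
  set b := |2 * p * l - (p - 2)| with hb
  have ha2 : a ^ 2 = 8 * p * n + (p - 2) ^ 2 := by rw [ha, sq_abs]; linear_combination -4 * p * hk
  have hb2 : b ^ 2 = 8 * p * (n + 1) + (p - 2) ^ 2 := by
    rw [hb, sq_abs]; linear_combination -4 * p * hl
  have ha0 : 0 ≤ a := abs_nonneg _
  have hb0 : 0 ≤ b := abs_nonneg _
  have hab : a + 1 ≤ b := by
    by_contra! hc
    nlinarith
  have ha8 : 8 * (p : ℤ) ≤ a := by
    by_contra! hc
    nlinarith
  nlinarith

theorem exists_even_singularOverpartition {p m : ℕ} (hp : 5 ≤ p) (hm : 8 * p ≤ m) :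
    ∃ i, m < i ∧ i ≤ 10 * m ^ 2 ∧ Even (singularOverpartition p 1 i) := by
  by_contra! hcon
  have hodd : ∀ i, m < i → i ≤ 10 * m ^ 2 → (singularOverpartition p 1 i : ZMod 2) = 1 :=
    fun i h1 h2 => ZMod.natCast_eq_one_iff_odd.mpr (Nat.not_even_iff_odd.mp (hcon i h1 h2))
  have e1 := two_mul_natCast_pentagonal_neg (m + 1 : ℕ)
  have e2 := two_mul_natCast_pentagonal ((m + 1 : ℕ) + 1)
  set u := pentagonal (-(m + 1 : ℕ)) with hu
  push_cast at e1 e2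
  have hbound : u + m + 2 ≤ 10 * m ^ 2 := by
    zify at hm hp ⊢
    nlinarith
  have hlt : u + m + 2 < pentagonal ((m + 1 : ℕ) + 1) := by
    zify
    nlinarith
  have hne : ∀ n, u + m < n → n ≤ u + m + 2 → ∃ k : ℤ, 2 * (n : ℤ) = k * (p * k - (p - 2)) := by
    intro n h1 h2
    refine exists_of_coeff_mul_pentagonalSeries_ne_zero hp ?_
    rw [coeff_mul_pentagonalSeries_eq_one h1 (by omega)
      fun i hi hin => hodd i hi (by omega)]
    exact one_ne_zero
  obtain ⟨k, hk⟩ := hne (u + m + 1) (by omega) (by omega)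
  obtain ⟨l, hl⟩ := hne (u + m + 1 + 1) (by omega) (by omega)
  exact not_exists_and_exists_succ hp (by omega) hk hl

theorem le_card_even_singularOverpartition {p : ℕ} (hp : 5 ≤ p) (r : ℕ) :
    r ≤ ((Icc 1 ((8 * p) ^ 3 ^ r)).filter fun n => Even (singularOverpartition p 1 n)).card := by
  induction r with
  | zero => exact Nat.zero_le _
  | succ r ih =>
    set a := (8 * p) ^ 3 ^ r with ha
    have hpa : 8 * p ≤ a := Nat.le_self_pow (by positivity) _
    obtain ⟨i, hi1, hi2, hi3⟩ := exists_even_singularOverpartition hp hpa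
    have hpow : (8 * p) ^ 3 ^ (r + 1) = a ^ 3 := by rw [pow_succ, pow_mul]
    have hia : i ≤ a ^ 3 := by nlinarith [sq_nonneg a]
    rw [hpow]
    refine (Nat.succ_le_succ ih).trans ?_
    rw [Nat.succ_eq_add_one, ← card_insert_of_notMem (a := i)]
    · refine card_le_card fun x hx => ?_
      simp only [mem_insert, mem_filter, mem_Icc] at hx ⊢
      rcases hx with rfl | ⟨⟨h1, h2⟩, h3⟩
      · exact ⟨⟨by omega, hia⟩, hi3⟩
      · exact ⟨⟨h1, by omega⟩, h3⟩
    · simp only [mem_filter, mem_Icc]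
      omega

end EvenValues

theorem stmt_2 (p : ℕ) (hp : p.Prime) (hp5 : 5 ≤ p) :
    ∃ α : ℝ, 0 < α ∧ ∀ᶠ X : ℝ in Filter.atTop,
      α * Real.log (Real.log X) ≤
        (((Finset.Icc 1 ⌊X⌋₊).filter fun n => Even (singularOverpartition p 1 n)).card : ℝ) := by
  have h3 : 0 < Real.log 3 := Real.log_pos (by norm_num)
  refine ⟨1 / (2 * Real.log 3), by positivity, ?_⟩
  set a : ℕ := 8 * p with ha
  have ha1 : (1 : ℝ) < a := by exact_mod_cast (by omega : 1 < a)
  have hla : 0 < Real.log a := Real.log_pos ha1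
  have hloglog : Filter.Tendsto (fun X : ℝ => Real.log (Real.log X)) Filter.atTop Filter.atTop :=
    Real.tendsto_log_atTop.comp Real.tendsto_log_atTop
  filter_upwards [hloglog.eventually_ge_atTop (2 * (|Real.log (Real.log a)| + Real.log 3)),
    Real.tendsto_log_atTop.eventually_ge_atTop 1, Filter.eventually_gt_atTop 0] with X hX hX1 hX0
  set L := Real.log (Real.log X) with hL
  have habs := le_abs_self (Real.log (Real.log a))
  have habs0 := abs_nonneg (Real.log (Real.log a))
  set t := (L - Real.log (Real.log a)) / Real.log 3 with ht
  have ht0 : 0 ≤ t := div_nonneg (by linarith) h3.le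
  have hfloor : (a : ℝ) ^ 3 ^ ⌊t⌋₊ ≤ X := by
    rw [← Real.log_le_log_iff (by positivity) hX0, Real.log_pow,
      ← Real.log_le_log_iff (by positivity) (by linarith), Real.log_mul (by positivity) hla.ne']
    push_cast
    rw [Real.log_pow]
    have := (le_div_iff₀ h3).mp (Nat.floor_le ht0)
    linarith
  have hcard := le_card_even_singularOverpartition hp5 ⌊t⌋₊
  have hsub : ((Icc 1 ((8 * p) ^ 3 ^ ⌊t⌋₊)).filter fun n => Even (singularOverpartition p 1 n)).card
      ≤ ((Icc 1 ⌊X⌋₊).filter fun n => Even (singularOverpartition p 1 n)).card := by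
    refine card_le_card (filter_subset_filter _ (Icc_subset_Icc le_rfl ?_))
    rw [← ha]
    exact Nat.le_floor (by exact_mod_cast hfloor)
  calc 1 / (2 * Real.log 3) * L ≤ t - 1 := by
        rw [ht, div_sub_one h3.ne', div_mul_eq_mul_div, one_mul, div_le_div_iff₀ (by positivity) h3]
        nlinarith
    _ ≤ ⌊t⌋₊ := (Nat.sub_one_lt_floor t).le
    _ ≤ _ := by exact_mod_cast hcard.trans hsub
end

section
/- For every prime p ≥ 5 there exists a constant β > 0 such that for all sufficiently large real numbers X, the number of integers n with 1 ≤ n ≤ X and C̄_{p,1}(n) odd is at least β·log(log X). -/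
open PowerSeries

/-- The finite `q`-Pochhammer product `(q; q)_n`. -/
def qPoch {R : Type*} [CommRing R] (q : R) (n : ℕ) : R := ∏ i ∈ Finset.range n, (1 - q ^ (i + 1))

/-- The Gaussian binomial coefficient `[a + b choose a]` in the variable `q`. -/
def gaussBinom {R : Type*} [CommRing R] (q : R) : ℕ → ℕ → R
  | 0, _ => 1
  | _ + 1, 0 => 1
  | a + 1, b + 1 => gaussBinom q (a + 1) b + q ^ (b + 1) * gaussBinom q a (b + 1)

section Ring

variable {R : Type*} [CommRing R]

theorem qPoch_succ (q : R) (n : ℕ) : qPoch q (n + 1) = qPoch q n * (1 - q ^ (n + 1)) :=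
  Finset.prod_range_succ _ _

theorem gaussBinom_zero_right (q : R) (a : ℕ) : gaussBinom q a 0 = 1 := by
  cases a <;> simp [gaussBinom]

theorem gaussBinom_mul_qPoch (q : R) (a b : ℕ) :
    gaussBinom q a b * (qPoch q a * qPoch q b) = qPoch q (a + b) := by
  induction a generalizing b with
  | zero => simp [gaussBinom, qPoch]
  | succ a iha =>
    induction b with
    | zero => simp [gaussBinom, qPoch]
    | succ b ihb =>
      have h1 := iha (b + 1)
      rw [show a + 1 + (b + 1) = (a + 1 + b) + 1 by ring, qPoch_succ q (a + 1 + b), gaussBinom, add_mul]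
      rw [show a + (b + 1) = a + 1 + b by ring] at h1
      rw [qPoch_succ q a] at ihb ⊢
      rw [qPoch_succ q b] at h1 ⊢
      linear_combination (1 - q ^ (b + 1)) * ihb + q ^ (b + 1) * (1 - q ^ (a + 1)) * h1

theorem prod_add_mul_pow (q y z : R) (n : ℕ) :
    ∏ i ∈ Finset.range n, (y + z * q ^ i) =
      ∑ x ∈ Finset.HasAntidiagonal.antidiagonal n,
        q ^ (x.1.choose 2) * gaussBinom q x.1 x.2 * z ^ x.1 * y ^ x.2 := by
  induction n with
  | zero => simp [gaussBinom]
  | succ n ih =>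
    let F : ℕ → ℕ → R := fun a b ↦ q ^ (a.choose 2) * gaussBinom q a b * z ^ a * y ^ b
    let U : ℕ → ℕ → R := fun a b ↦ b.casesOn 0 fun b ↦ F a b * y
    let V : ℕ → ℕ → R := fun a b ↦ a.casesOn 0 fun a ↦ F a b * (z * q ^ (a + b))
    have hF : ∀ a b, a + b = n + 1 → F a b = U a b + V a b := by
      intro a b h
      rcases a with _ | a <;> rcases b with _ | b
      · simp at h
      · simp [F, U, V, gaussBinom]; ring
      · simp [F, U, V, gaussBinom_zero_right, Nat.choose_succ_succ' a 1]; ring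
      · simp [F, U, V, gaussBinom, Nat.choose_succ_succ' a 1]; ring
    have hU : ∑ x ∈ Finset.HasAntidiagonal.antidiagonal (n + 1), U x.1 x.2 =
        (∑ x ∈ Finset.HasAntidiagonal.antidiagonal n, F x.1 x.2) * y := by
      rw [Finset.Nat.sum_antidiagonal_succ', Finset.sum_mul]
      simp [U]
    have hV : ∑ x ∈ Finset.HasAntidiagonal.antidiagonal (n + 1), V x.1 x.2 =
        (∑ x ∈ Finset.HasAntidiagonal.antidiagonal n, F x.1 x.2) * (z * q ^ n) := by
      rw [Finset.Nat.sum_antidiagonal_succ, Finset.sum_mul]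
      have : ∀ x ∈ Finset.HasAntidiagonal.antidiagonal n,
          F x.1 x.2 * (z * q ^ n) = V (x.1 + 1) x.2 := by
        intro x hx
        simp [V, Finset.HasAntidiagonal.mem_antidiagonal.mp hx]
      rw [Finset.sum_congr rfl this]
      simp [V]
    rw [Finset.prod_range_succ, ih, mul_add, ← hU, ← hV, ← Finset.sum_add_distrib]
    exact Finset.sum_congr rfl fun x hx ↦ (hF _ _ (Finset.HasAntidiagonal.mem_antidiagonal.mp hx)).symm

theorem pow_dvd_qPoch_sub (q : R) {m n : ℕ} (h : m ≤ n) :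
    q ^ (m + 1) ∣ qPoch q n - qPoch q m := by
  induction n, h using Nat.le_induction with
  | base => simp
  | succ n hn ih =>
    rw [qPoch_succ, show qPoch q n * (1 - q ^ (n + 1)) - qPoch q m
      = (qPoch q n - qPoch q m) - q ^ (n + 1) * qPoch q n by ring]
    exact dvd_sub ih (Dvd.dvd.mul_right (pow_dvd_pow q (by omega)) _)

theorem pow_dvd_gaussBinom_mul_qPoch_sub_one {q : R} (hq : ∀ n, IsUnit (qPoch q n)) {a b m N : ℕ}
    (ha : m ≤ a) (hb : m ≤ b) (hN : m ≤ N) :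
    q ^ (m + 1) ∣ gaussBinom q a b * qPoch q N - 1 := by
  obtain ⟨A, hA⟩ := pow_dvd_qPoch_sub q ha
  obtain ⟨B, hB⟩ := pow_dvd_qPoch_sub q hb
  obtain ⟨C, hC⟩ := pow_dvd_qPoch_sub q hN
  obtain ⟨D, hD⟩ := pow_dvd_qPoch_sub q (show m ≤ a + b by omega)
  have h := gaussBinom_mul_qPoch q a b
  rw [← (hq m).dvd_mul_right]
  rw [sub_eq_iff_eq_add] at hA hB hC hD
  rw [hD, hA, hB] at h
  rw [hC]
  refine ⟨gaussBinom q a b * C * qPoch q m + D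
    - gaussBinom q a b * (A * (q ^ (m + 1) * B + qPoch q m) + B * qPoch q m), ?_⟩
  linear_combination h

end Ring

theorem isUnit_qPoch_X_pow {R : Type*} [CommRing R] {p : ℕ} (hp : p ≠ 0) (n : ℕ) :
    IsUnit (qPoch ((X : R⟦X⟧) ^ p) n) := by
  rw [PowerSeries.isUnit_iff_constantCoeff]
  simp [qPoch, hp]

theorem prod_X_pow_add (R : Type*) [CommRing R] {p : ℕ} (hp : 1 ≤ p) (N : ℕ) :
    ∏ i ∈ Finset.range (N + N), ((X : R⟦X⟧) ^ (p * N) + X * (X ^ p) ^ i) =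
      X ^ (N + p * N.choose 2 + p * N * N) *
      ∏ i ∈ Finset.range N, ((1 + X ^ (p * i + 1)) * (1 + X ^ (p * i + (p - 1)))) := by
  have h1 : ∏ i ∈ Finset.range N, ((X : R⟦X⟧) ^ (p * N) + X * (X ^ p) ^ i) =
      X ^ (N + p * N.choose 2) * ∏ i ∈ Finset.range N, (1 + X ^ (p * i + (p - 1))) := by
    rw [← Finset.prod_range_reflect (fun i ↦ (1 : R⟦X⟧) + X ^ (p * i + (p - 1)))]
    have : (X : R⟦X⟧) ^ (N + p * N.choose 2) = ∏ i ∈ Finset.range N, X ^ (1 + p * i) := by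
      rw [Finset.prod_pow_eq_pow_sum, Finset.sum_add_distrib, ← Finset.mul_sum,
        Finset.sum_range_id, Nat.choose_two_right]
      simp
    rw [this, ← Finset.prod_mul_distrib]
    refine Finset.prod_congr rfl fun i hi ↦ ?_
    rw [mul_add, mul_one, ← pow_add, ← pow_mul, ← pow_succ', add_comm]
    congr 2
    · ring
    · obtain ⟨k, rfl⟩ : ∃ k, N = i + 1 + k := Nat.exists_eq_add_of_le (Finset.mem_range.mp hi)
      obtain ⟨r, rfl⟩ := Nat.exists_eq_add_of_le hp
      rw [show i + 1 + k - 1 - i = k by omega, show 1 + r - 1 = r by omega]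
      ring
  have h2 : ∏ i ∈ Finset.range N, ((X : R⟦X⟧) ^ (p * N) + X * (X ^ p) ^ (N + i)) =
      X ^ (p * N * N) * ∏ i ∈ Finset.range N, (1 + X ^ (p * i + 1)) := by
    rw [pow_mul X (p * N) N, ← Finset.card_range N, ← Finset.prod_const, Finset.card_range,
      ← Finset.prod_mul_distrib]
    refine Finset.prod_congr rfl fun i _ ↦ ?_
    ring
  rw [Finset.prod_range_add, h1, h2, Finset.prod_mul_distrib, pow_add _ (N + _)]
  ring

theorem coeff_theta_eq_zero {R : Type*} [CommRing R] {p : ℕ} (hp : 2 ≤ p) (hp3 : ¬ 3 ∣ p) {n N : ℕ}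
    (hn : n % 3 = 2) (hN : n ≤ N) :
    coeff n (qPoch ((X : R⟦X⟧) ^ p) N *
      ∏ i ∈ Finset.range N, ((1 + X ^ (p * i + 1)) * (1 + X ^ (p * i + (p - 1))))) = 0 := by
  set E := N + p * N.choose 2 + p * N * N with hE
  rw [← coeff_X_pow_mul _ E n, mul_left_comm, ← prod_X_pow_add R (by omega : 1 ≤ p) N, prod_add_mul_pow,
    Finset.mul_sum, map_sum]
  refine Finset.sum_eq_zero fun x hx ↦ ?_
  obtain ⟨a, b⟩ := x
  have hab : a + b = N + N := Finset.HasAntidiagonal.mem_antidiagonal.mp hx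
  obtain ⟨h, hh⟩ := pow_dvd_gaussBinom_mul_qPoch_sub_one
    (isUnit_qPoch_X_pow (R := R) (show p ≠ 0 by omega))
    (min_le_left a b) (min_le_right a b) (show min a b ≤ N by omega)
  set T := p * a.choose 2 + a + p * N * b with hT
  set m := min a b
  have hz : (2 * (T : ℤ) - 2 * E) = p * (a - N : ℤ) ^ 2 - (p - 2) * (a - N) := by
    have e : ∀ a : ℕ, 2 * ((a.choose 2 : ℕ) : ℤ) = a * (a - 1) := by
      intro a
      induction a with
      | zero => simp
      | succ a ih => rw [Nat.choose_succ_succ' a 1]; push_cast; simp; linarith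
    have hb : (b : ℤ) = N + N - a := by omega
    rw [hT, hE]
    push_cast
    rw [hb]
    linear_combination (p : ℤ) * e a - p * e N
  have hne : T ≠ n + E := by
    intro hc
    have h1 : 2 * (n : ℤ) = p * (a - N : ℤ) ^ 2 - (p - 2) * (a - N) := by
      rw [← hz, hc]; push_cast; ring
    generalize (a - N : ℤ) = j at h1
    have h2 := congrArg (Int.cast : ℤ → ZMod 3) h1
    push_cast at h2
    have hn3 : (n : ZMod 3) = 2 := by
      have := (ZMod.natCast_eq_natCast_iff n 2 3).mpr hn
      simpa using this
    have hp0 : (p : ZMod 3) ≠ 0 := by rwa [Ne, ZMod.natCast_eq_zero_iff]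
    rw [hn3] at h2
    revert h2 hp0
    generalize (p : ZMod 3) = u
    generalize (j : ZMod 3) = v
    revert u v
    decide
  have hge : n + E < T + p * (m + 1) := by
    have hj : |(a : ℤ) - N| = N - m := by
      rcases le_total a b with hle | hle
      · rw [abs_of_nonpos (by omega)]; omega
      · rw [abs_of_nonneg (by omega)]; omega
    have h3 : 2 * |(a : ℤ) - N| ≤ 2 * T - 2 * E := by
      rw [hz]
      have hp' : (2 : ℤ) ≤ p := by exact_mod_cast hp
      generalize (a : ℤ) - N = j
      rcases lt_trichotomy j 0 with h | h | h
      · rw [abs_of_neg h]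
        nlinarith [mul_nonneg (sub_nonneg.mpr hp')
          (mul_nonneg (show (0 : ℤ) ≤ -j by omega) (show (0 : ℤ) ≤ -j + 1 by omega)),
          mul_nonneg (show (0 : ℤ) ≤ -j by omega) (show (0 : ℤ) ≤ -j - 1 by omega)]
      · simp [h]
      · rw [abs_of_pos h]
        nlinarith [mul_nonneg (show (0 : ℤ) ≤ p by omega)
          (mul_nonneg (show (0 : ℤ) ≤ j by omega) (show (0 : ℤ) ≤ j - 1 by omega))]
    have : m + 1 ≤ p * (m + 1) := Nat.le_mul_of_pos_left _ (by omega)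
    omega
  have key : qPoch ((X : R⟦X⟧) ^ p) N * ((X ^ p) ^ (a.choose 2) * gaussBinom (X ^ p) a b * X ^ a *
      (X ^ (p * N)) ^ b) = X ^ T + X ^ (T + p * (m + 1)) * h := by
    rw [sub_eq_iff_eq_add] at hh
    have : (X : R⟦X⟧) ^ T = (X ^ p) ^ (a.choose 2) * X ^ a * (X ^ (p * N)) ^ b := by
      rw [hT]; ring
    rw [pow_add X T, pow_mul X p (m + 1), this]
    linear_combination (X ^ p) ^ (a.choose 2) * X ^ a * (X ^ (p * N)) ^ b * hh
  simp only [key, map_add, coeff_X_pow, coeff_X_pow_mul']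
  rw [if_neg (Ne.symm hne), if_neg (by omega), add_zero]

/-- The parts that contribute to the parity of `singularOverpartition p 1`: those not congruent
to `0`, `1` or `-1` modulo `p`. -/
def IsParityPart (p m : ℕ) : Prop :=
  ¬ p ∣ m ∧ (m : ZMod p) ≠ 1 ∧ (m : ZMod p) ≠ -1

instance (p : ℕ) : DecidablePred (IsParityPart p) := fun _ ↦ inferInstanceAs (Decidable (_ ∧ _))

theorem singularOverpartition_cast_zmod_two (p n : ℕ) :
    (singularOverpartition p 1 n : ZMod 2) =
      ((Nat.Partition.restricted n (IsParityPart p)).card : ZMod 2) := by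
  classical
  let t : n.Partition → Finset ℕ := fun P ↦
    P.parts.toFinset.filter fun x ↦ (x : ZMod p) = 1 ∨ (x : ZMod p) = -1
  have h : singularOverpartition p 1 n =
      (((Nat.Partition.restricted n (¬ p ∣ ·)).sigma fun P ↦ (t P).powerset).map
        (Equiv.sigmaEquivProd _ _).toEmbedding).card := by
    refine Nat.subtype_card _ ?_
    rintro ⟨P, S⟩
    simp only [Finset.mem_map_equiv, Equiv.sigmaEquivProd_symm_apply, Finset.mem_sigma,
      Nat.Partition.restricted, Finset.mem_filter, Finset.mem_univ, true_and,
      Finset.mem_powerset, t, Finset.subset_iff, Nat.cast_one]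
    grind
  rw [h, Finset.card_map, Finset.card_sigma]
  have h2 : ∀ P : n.Partition, (((t P).powerset.card : ℕ) : ZMod 2) = if t P = ∅ then 1 else 0 := by
    intro P
    rw [Finset.card_powerset]
    split_ifs with hP
    · simp [hP]
    · have : (t P).card ≠ 0 := by simpa using hP
      push_cast
      rw [show (2 : ZMod 2) = 0 from rfl, zero_pow this]
  rw [Nat.cast_sum, Finset.sum_congr rfl fun P _ ↦ h2 P, Finset.sum_boole]
  congr 2
  ext P
  simp only [Nat.Partition.restricted, Finset.mem_filter, Finset.mem_univ, true_and, t,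
    Finset.filter_eq_empty_iff, Multiset.mem_toFinset, IsParityPart]
  grind

theorem prod_range_ite_isParityPart {p : ℕ} (hp : 3 ≤ p) (N : ℕ) :
    ∏ i ∈ Finset.range (p * N),
      (if IsParityPart p (i + 1) then (1 : (ZMod 2)⟦X⟧) else 1 - X ^ (i + 1)) =
    qPoch ((X : (ZMod 2)⟦X⟧) ^ p) N *
      ∏ i ∈ Finset.range N, ((1 + X ^ (p * i + 1)) * (1 + X ^ (p * i + (p - 1)))) := by
  induction N with
  | zero => simp [qPoch]
  | succ N ih =>
    obtain ⟨r, rfl⟩ := Nat.exists_eq_add_of_le' hp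
    have key : ∀ j < r + 3, IsParityPart (r + 3) ((r + 3) * N + j + 1) ↔
        ¬ (j = 0 ∨ j = r + 1 ∨ j = r + 2) := by
      intro j hj
      have e1 : (r + 3) ∣ (r + 3) * N + j + 1 ↔ j = r + 2 := by
        rw [add_assoc, Nat.dvd_add_right (Dvd.intro _ rfl)]
        constructor
        · intro h; have := Nat.le_of_dvd (by omega) h; omega
        · rintro rfl; exact dvd_rfl
      have e2 : (((r + 3) * N + j + 1 : ℕ) : ZMod (r + 3)) = 1 ↔ j = 0 := by
        rw [show (((r + 3) * N + j + 1 : ℕ) : ZMod (r + 3)) = (j : ZMod (r + 3)) + 1 by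
          rw [add_assoc, Nat.cast_add, Nat.cast_mul, ZMod.natCast_self]; simp]
        rw [add_eq_right, ZMod.natCast_eq_zero_iff]
        exact ⟨fun h ↦ Nat.eq_zero_of_dvd_of_lt h hj, by rintro rfl; simp⟩
      have e3 : (((r + 3) * N + j + 1 : ℕ) : ZMod (r + 3)) = -1 ↔ j = r + 1 := by
        rw [show (((r + 3) * N + j + 1 : ℕ) : ZMod (r + 3)) = (j : ZMod (r + 3)) + 1 by
          rw [add_assoc, Nat.cast_add, Nat.cast_mul, ZMod.natCast_self]; simp]
        rw [eq_neg_iff_add_eq_zero]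
        have : (j : ZMod (r + 3)) + 1 + 1 = ((j + 2 : ℕ) : ZMod (r + 3)) := by push_cast; ring
        rw [this, ZMod.natCast_eq_zero_iff]
        constructor
        · rintro ⟨c, hc⟩
          have : c = 1 := by
            have : c < 2 := by by_contra! h; nlinarith
            interval_cases c <;> omega
          subst this; omega
        · rintro rfl; exact dvd_rfl
      unfold IsParityPart
      rw [e1, Ne, Ne, e2, e3]
      tauto
    rw [mul_add, mul_one, Finset.prod_range_add, ih, qPoch_succ, Finset.prod_range_succ _ N]
    have : ∏ j ∈ Finset.range (r + 3), (if IsParityPart (r + 3) ((r + 3) * N + j + 1)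
          then (1 : (ZMod 2)⟦X⟧) else 1 - X ^ ((r + 3) * N + j + 1)) =
        (1 - X ^ ((r + 3) * N + 1)) * ((1 - X ^ ((r + 3) * N + (r + 2))) *
          (1 - X ^ ((r + 3) * N + (r + 3)))) := by
      have h0 : ∀ j ∈ Finset.range r, (if IsParityPart (r + 3) ((r + 3) * N + (j + 1) + 1)
          then (1 : (ZMod 2)⟦X⟧) else 1 - X ^ ((r + 3) * N + (j + 1) + 1)) = 1 := by
        intro j hj
        have := Finset.mem_range.mp hj
        rw [if_pos ((key _ (by omega)).mpr (by omega))]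
      rw [Finset.prod_range_succ, Finset.prod_range_succ, Finset.prod_range_succ',
        Finset.prod_eq_one h0, if_neg (by rw [key 0 (by omega)]; simp),
        if_neg (by rw [key (r + 1) (by omega)]; simp),
        if_neg (by rw [key (r + 2) (by omega)]; simp)]
      simp only [add_zero, add_assoc]
      ring
    rw [this]
    have sgn : ∀ x : (ZMod 2)⟦X⟧, 1 - x = 1 + x := fun x ↦ by
      ext n
      rw [map_sub, map_add, CharTwo.sub_eq_add]
    rw [sgn (X ^ ((r + 3) * N + 1)), sgn (X ^ ((r + 3) * N + (r + 2))),
      show r + 3 - 1 = r + 2 from rfl]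
    ring

open scoped PowerSeries.WithPiTopology in
theorem coeff_restricted_mul_pentagonalSeries_eq_zero {p : ℕ} (hp : 3 ≤ p) (hp3 : ¬ 3 ∣ p) {n : ℕ}
    (hn : n % 3 = 2) :
    coeff n ((PowerSeries.mk fun n ↦
      ((Nat.Partition.restricted n (IsParityPart p)).card : ZMod 2)) *
        pentagonalSeries (ZMod 2)) = 0 := by
  let _ : TopologicalSpace (ZMod 2) := ⊥
  have _ : DiscreteTopology (ZMod 2) := ⟨rfl⟩
  have h := (Nat.Partition.hasProd_powerSeriesMk_card_restricted (ZMod 2) (IsParityPart p)).mul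
    (WithPiTopology.hasProd_one_sub_X_pow (ZMod 2))
  have h2 : ∀ i : ℕ, (if IsParityPart p (i + 1) then ∑' j : ℕ, (X : (ZMod 2)⟦X⟧) ^ ((i + 1) * j)
      else 1) * (1 - X ^ (i + 1)) = if IsParityPart p (i + 1) then 1 else 1 - X ^ (i + 1) := by
    intro i
    split_ifs
    · simp_rw [pow_mul]
      exact WithPiTopology.tsum_pow_mul_one_sub_of_constantCoeff_eq_zero (by simp)
    · rw [one_mul]
  simp_rw [h2] at h
  rw [HasProd, WithPiTopology.tendsto_iff_coeff_tendsto] at h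
  have h3 := h n
  rw [nhds_discrete, Filter.tendsto_pure] at h3
  obtain ⟨s, hs⟩ := Filter.eventually_atTop.mp h3
  obtain ⟨M, hM⟩ := s.exists_nat_subset_range
  have hle : M ≤ p * (M + n) := by nlinarith
  rw [← hs (Finset.range (p * (M + n))) (hM.trans (Finset.range_subset_range.mpr hle)),
    prod_range_ite_isParityPart hp]
  exact coeff_theta_eq_zero (by omega) hp3 hn (by omega)

theorem pentagonal_add_le_of_lt {k l : ℤ} (hk : 0 < k) (h : pentagonal l < pentagonal k) :
    (pentagonal l : ℤ) + (2 * k - 1) ≤ pentagonal k := by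
  have h1 := two_mul_natCast_pentagonal k
  have h2 := two_mul_natCast_pentagonal l
  have h3 : (pentagonal l : ℤ) < pentagonal k := by exact_mod_cast h
  have h4 : l ≤ k - 1 := by by_contra! h; nlinarith
  have h5 : -(k - 1) ≤ l := by by_contra! h; nlinarith
  nlinarith [mul_nonneg (sub_nonneg.mpr h4) (show 0 ≤ l + (k - 1) by omega)]

theorem exists_odd_singularOverpartition {p : ℕ} (hp : 3 ≤ p) (hp3 : ¬ 3 ∣ p) {k : ℕ}
    (hk : k % 3 = 2) :
    ∃ n, 2 * k - 1 ≤ n ∧ n ≤ pentagonal k ∧ Odd (singularOverpartition p 1 n) := by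
  have hw : pentagonal k % 3 = 2 := by
    have h := two_mul_natCast_pentagonal k
    obtain ⟨m, rfl⟩ : ∃ m, k = 3 * m + 2 := ⟨k / 3, by omega⟩
    have : (2 * (pentagonal ((3 * m + 2 : ℕ) : ℤ)) : ℤ) =
        3 * (((3 * m + 2 : ℕ) : ℤ) * (3 * m + 2) - m - 1) + 1 := by
      rw [h]; push_cast; ring
    omega
  have h := coeff_restricted_mul_pentagonalSeries_eq_zero hp hp3 hw
  rw [coeff_mul] at h
  simp only [coeff_mk] at h
  by_contra! hcon
  rw [Finset.sum_eq_single (0, pentagonal k)] at h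
  · have h0 : (Nat.Partition.restricted 0 (IsParityPart p)).card = 1 := by
      rw [Finset.card_eq_one]
      exact ⟨default, by ext P; simp [Nat.Partition.restricted, Subsingleton.elim P default]⟩
    rw [h0, Nat.cast_one, one_mul, coeff_pentagonalSeries_eq_zero_iff] at h
    exact h ⟨k, rfl⟩
  · rintro ⟨i, j⟩ hij hne
    have hij' : i + j = pentagonal k := Finset.HasAntidiagonal.mem_antidiagonal.mp hij
    by_cases hj : j ∈ Set.range pentagonal
    · obtain ⟨l, rfl⟩ := hj
      have hi : i ≠ 0 := by
        rintro rfl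
        exact hne (by simp_all)
      have := pentagonal_add_le_of_lt (k := k) (l := l) (by omega) (by omega)
      have h0 := hcon i (by omega) (by omega)
      rw [← singularOverpartition_cast_zmod_two,
        ZMod.natCast_eq_zero_iff_even.mpr (Nat.not_odd_iff_even.mp h0), zero_mul]
    · rw [coeff_pentagonalSeries_eq_zero _ hj, mul_zero]
  · intro h0
    exact absurd (Finset.HasAntidiagonal.mem_antidiagonal.mpr (zero_add _)) h0

/-- Indices `≡ 2 [MOD 3]` for which the intervals `[2 k - 1, pentagonal k]` are disjoint. -/
def sparseIndex : ℕ → ℕ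
  | 0 => 2
  | j + 1 => sparseIndex j ^ 2 + 1

theorem sparseIndex_mod_three (j : ℕ) : sparseIndex j % 3 = 2 := by
  induction j with
  | zero => rfl
  | succ j ih => simp [sparseIndex, Nat.add_mod, Nat.pow_mod, ih]

theorem sparseIndex_succ_le (j : ℕ) : sparseIndex j + 1 ≤ 3 ^ 2 ^ j := by
  induction j with
  | zero => simp [sparseIndex]
  | succ j ih =>
    rw [pow_succ 2, pow_mul, sparseIndex]
    have := Nat.pow_le_pow_left ih 2
    nlinarith [sparseIndex_mod_three j, Nat.mod_le (sparseIndex j) 3]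

theorem le_card_odd_singularOverpartition {p : ℕ} (hp : 3 ≤ p) (hp3 : ¬ 3 ∣ p) {J N : ℕ}
    (hN : 27 ^ 2 ^ J ≤ N) :
    J ≤ ((Finset.Icc 1 N).filter fun n => Odd (singularOverpartition p 1 n)).card := by
  choose f h1 h2 h3 using fun j ↦
    exists_odd_singularOverpartition hp hp3 (sparseIndex_mod_three j)
  have hpent : ∀ k : ℕ, 2 * pentagonal k ≤ 3 * k ^ 2 := by
    intro k
    have := two_mul_natCast_pentagonal k
    zify
    nlinarith
  have hge : ∀ j, 2 ≤ sparseIndex j := fun j ↦ by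
    have := sparseIndex_mod_three j; omega
  have hf : StrictMono f := by
    refine strictMono_nat_of_lt_succ fun j ↦ ?_
    have a := h1 (j + 1)
    have b := h2 j
    have c := hpent (sparseIndex j)
    rw [sparseIndex] at a
    omega
  have hsub : (Finset.range J).image f ⊆
      (Finset.Icc 1 N).filter fun n => Odd (singularOverpartition p 1 n) := by
    intro n hn
    obtain ⟨j, hj, rfl⟩ := Finset.mem_image.mp hn
    have hjJ : f j ≤ f J := hf.monotone (Finset.mem_range.mp hj).le
    have a := h1 j
    have b := hge j
    refine Finset.mem_filter.mpr ⟨Finset.mem_Icc.mpr ⟨by omega, ?_⟩, h3 j⟩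
    have c := hpent (sparseIndex J)
    have d := Nat.pow_le_pow_left (sparseIndex_succ_le J) 3
    rw [← pow_mul, mul_comm, pow_mul] at d
    norm_num at d
    have e := h2 J
    nlinarith [hge J]
  calc J = ((Finset.range J).image f).card := by
        rw [Finset.card_image_of_injective _ hf.injective, Finset.card_range]
    _ ≤ _ := Finset.card_le_card hsub

theorem stmt_5 (p : ℕ) (hp : p.Prime) (hp5 : 5 ≤ p) :
    ∃ β : ℝ, 0 < β ∧ ∀ᶠ X : ℝ in Filter.atTop,
      β * Real.log (Real.log X) ≤
        (((Finset.Icc 1 ⌊X⌋₊).filter fun n => Odd (singularOverpartition p 1 n)).card : ℝ) := by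
  have hp3 : ¬ 3 ∣ p := fun h ↦ by
    have := (Nat.prime_dvd_prime_iff_eq Nat.prime_three hp).mp h
    omega
  refine ⟨1 / 2, by norm_num, ?_⟩
  have htend := Real.tendsto_log_atTop.comp Real.tendsto_log_atTop
  filter_upwards [htend.eventually_ge_atTop 12, Filter.eventually_gt_atTop 1] with X hX hX1
  simp only [Function.comp_apply] at hX
  set L := Real.log (Real.log X) with hL
  have hlog : 0 < Real.log X := Real.log_pos hX1
  set J := ⌊L - 5⌋₊ with hJ
  have hJ1 : (J : ℝ) ≤ L - 5 := Nat.floor_le (by linarith)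
  have hJ2 : L - 5 < J + 1 := Nat.lt_floor_add_one _
  have hexp : (2 : ℝ) ^ J * 27 ≤ Real.log X := by
    have h2 : (2 : ℝ) ≤ Real.exp 1 := by linarith [Real.add_one_le_exp 1]
    calc (2 : ℝ) ^ J * 27 ≤ (2 : ℝ) ^ J * 2 ^ 5 := by gcongr; norm_num
      _ = 2 ^ (J + 5) := by ring
      _ ≤ Real.exp 1 ^ (J + 5) := by gcongr
      _ = Real.exp (J + 5) := by rw [← Real.exp_nat_mul]; simp
      _ ≤ Real.exp L := Real.exp_le_exp.mpr (by linarith)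
      _ = Real.log X := Real.exp_log hlog
  have hN : 27 ^ 2 ^ J ≤ ⌊X⌋₊ := by
    refine Nat.le_floor ?_
    push_cast
    calc (27 : ℝ) ^ 2 ^ J ≤ Real.exp 27 ^ 2 ^ J := by
          gcongr; linarith [Real.add_one_le_exp 27]
      _ = Real.exp (2 ^ J * 27) := by rw [← Real.exp_nat_mul]; simp
      _ ≤ Real.exp (Real.log X) := Real.exp_le_exp.mpr hexp
      _ = X := Real.exp_log (by linarith)
  have := le_card_odd_singularOverpartition (p := p) (by omega) hp3 hN
  have h' : (J : ℝ) ≤ _ := Nat.cast_le.mpr this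
  linarith
end
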